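/- arXiv:2505.10964 — 2 statements merged into one kernel-verified Lean document; each statement's English description precedes it below -/
import Mathlib

section
/- Let D be a bounded proper subdomain of ℂ and let f be an injective holomorphic map on D such that D' = f(D) is a bounded proper subdomain of ℂ. Then for all x, y ∈ D, (1/8)·m_D(x, y) ≤ m_{D'}(f(x), f(y)) ≤ 8·m_D(x, y). -/
open Metric Set

variable {E : Type*} [NormedAddCommGroup E] [NormedSpace ℝ E]

/-- δ_D(z): the Euclidean distance from `z` to the boundary `∂D`. -/
noncomputable def bdist (D : Set E) (z : E) : ℝ := Metric.infDist z (frontier D)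

/-- The m-density `m_D(z) = d(D) / (δ_D(z)·(d(D) − δ_D(z)))`. -/
noncomputable def mDensity (D : Set E) (z : E) : ℝ :=
  Metric.diam D / (bdist D z * (Metric.diam D - bdist D z))

/-- A rectifiable path in `D` from `x` to `y`, modeled as a Lipschitz map on `[0,1]`. -/
def IsRectPathIn (D : Set E) (x y : E) (γ : ℝ → E) : Prop :=
  (∃ K : NNReal, LipschitzWith K γ) ∧ γ 0 = x ∧ γ 1 = y ∧ ∀ t ∈ Set.Icc (0:ℝ) 1, γ t ∈ D

/-- The line integral `∫_γ ρ(z) |dz|` of a density `ρ` along a path `γ`. -/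
noncomputable def pathIntegral (ρ : E → ℝ) (γ : ℝ → E) : ℝ :=
  ∫ t in (0:ℝ)..1, ρ (γ t) * ‖deriv γ t‖

/-- `inf_γ ∫_γ ρ(z)|dz|` over all rectifiable paths `γ` joining `x` and `y` in `D`. -/
noncomputable def pathDist (ρ : E → ℝ) (D : Set E) (x y : E) : ℝ :=
  sInf (pathIntegral ρ '' {γ | IsRectPathIn D x y γ})

/-- The metric `m_D`. -/
noncomputable def mDist (D : Set E) (x y : E) : ℝ := pathDist (mDensity D) D x y

/-- The quasihyperbolic metric `k_D`. -/
noncomputable def kDist (D : Set E) (x y : E) : ℝ :=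
  pathDist (fun z => 1 / bdist D z) D x y

open MeasureTheory
open scoped Topology

lemma aux_ofReal {α : Type*} [MeasurableSpace α] (μ : Measure α) (f : α → ℝ) (hf : Integrable f μ) :
    ENNReal.ofReal (∫ x, f x ∂μ) ≤ ∫⁻ x, ENNReal.ofReal (f x) ∂μ := by
  rw [integral_eq_lintegral_pos_part_sub_lintegral_neg_part hf]
  refine le_trans (ENNReal.ofReal_le_ofReal (sub_le_self _ ENNReal.toReal_nonneg)) ?_
  exact ENNReal.ofReal_toReal_le

/-- mean value property on `(-π, π)`. -/
lemma aux_mean (P : ℂ → ℂ) (s : ℝ) (hs : 0 < s) (hP : DiffContOnCl ℂ P (ball 0 s)) :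
    ∫ θ in (-Real.pi)..Real.pi, (P (circleMap 0 s θ)).re = 2 * Real.pi * (P 0).re := by
  have h1 : Real.circleAverage P 0 s = P 0 :=
    DiffContOnCl.circleAverage (by rwa [abs_of_pos hs])
  rw [Real.circleAverage_eq_integral_add (-Real.pi),
    intervalIntegral.integral_comp_add_right (fun θ => P (circleMap 0 s θ))] at h1
  have e1 : (0:ℝ) + -Real.pi = -Real.pi := by ring
  have e2 : 2 * Real.pi + -Real.pi = Real.pi := by ring
  rw [e1, e2] at h1
  have hc : Continuous fun θ => P (circleMap 0 s θ) := by
    have : ContinuousOn P (closedBall 0 s) := by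
      have := hP.continuousOn; rwa [closure_ball _ hs.ne'] at this
    refine this.comp_continuous (continuous_circleMap 0 s) fun θ => circleMap_mem_closedBall 0 hs.le θ
  have h2 : (∫ θ in (-Real.pi)..Real.pi, (P (circleMap 0 s θ)).re)
      = (∫ θ in (-Real.pi)..Real.pi, P (circleMap 0 s θ)).re := by
    have := Complex.reCLM.intervalIntegral_comp_comm (hc.intervalIntegrable (μ := volume) (-Real.pi) Real.pi)
    simpa using this
  rw [h2, ← h1]
  have := Real.pi_pos
  simp
  field_simp

lemma aux_inner (k : ℂ → ℂ) (b : ℂ) (s : ℝ) (hs : 0 < s) (hk : DiffContOnCl ℂ k (ball 0 s))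
    (hk0 : k 0 = 0) (g : ℂ → ℂ) (hg : ∀ z, ‖z‖ = s → g z = - 1 / z ^ 2 + b + k z) :
    ENNReal.ofReal (2 * Real.pi * (1 / s ^ 4 + ‖b‖ ^ 2)) ≤
      ∫⁻ θ in Ioo (-Real.pi) Real.pi, ENNReal.ofReal (‖g (circleMap 0 s θ)‖ ^ 2) := by
  set P : ℂ → ℂ := fun z => ((1 / s ^ 4 + ‖b‖ ^ 2 : ℝ) : ℂ) - 2 * b * z ^ 2 * ((1 / s ^ 4 : ℝ) : ℂ)
    + 2 * (starRingEnd ℂ b - z ^ 2 * ((1 / s ^ 4 : ℝ) : ℂ)) * k z with hPdef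
  have hP : DiffContOnCl ℂ P (ball 0 s) := by
    have hid : ∀ q : ℂ → ℂ, Differentiable ℂ q → DiffContOnCl ℂ q (ball 0 s) := fun q hq => hq.diffContOnCl
    have := (hid (fun z => 2 * (starRingEnd ℂ b - z ^ 2 * ((1 / s ^ 4 : ℝ) : ℂ))) (by fun_prop)).smul hk
    exact (hid (fun z => ((1 / s ^ 4 + ‖b‖ ^ 2 : ℝ) : ℂ) - 2 * b * z ^ 2 * ((1 / s ^ 4 : ℝ) : ℂ)) (by fun_prop)).add this
  have hm := aux_mean P s hs hP
  have hP0 : (P 0).re = 1 / s ^ 4 + ‖b‖ ^ 2 := by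
    simp only [hPdef, hk0]; simp [-one_div, -Complex.ofReal_add, -Complex.ofReal_div, -Complex.ofReal_pow]
  rw [hP0] at hm
  have hc : Continuous fun θ => (P (circleMap 0 s θ)).re := by
    have : ContinuousOn P (closedBall 0 s) := by
      have := hP.continuousOn; rwa [closure_ball _ hs.ne'] at this
    exact Complex.continuous_re.comp (this.comp_continuous (continuous_circleMap 0 s) fun θ => circleMap_mem_closedBall 0 hs.le θ)
  rw [← hm, intervalIntegral.integral_of_le (by linarith [Real.pi_pos]), integral_Ioc_eq_integral_Ioo]
  calc _ ≤ ∫⁻ θ in Ioo (-Real.pi) Real.pi, ENNReal.ofReal ((P (circleMap 0 s θ)).re) := 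
        aux_ofReal _ _ (hc.integrableOn_Icc.mono_set Ioo_subset_Icc_self)
    _ ≤ _ := by
      apply lintegral_mono
      intro θ
      apply ENNReal.ofReal_le_ofReal
      set z := circleMap 0 s θ with hz
      have hzn : ‖z‖ = s := by simp [hz, abs_of_pos hs]
      rw [hg z hzn]
      have hz0 : z ≠ 0 := by
        intro h; rw [h, norm_zero] at hzn; linarith
      set a : ℂ := -1 / z ^ 2 with ha
      have hca : starRingEnd ℂ a = - z ^ 2 * ((1 / s ^ 4 : ℝ) : ℂ) := by
        have hzz : starRingEnd ℂ z = (s:ℂ) ^ 2 / z := by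
          rw [eq_div_iff hz0, mul_comm, Complex.mul_conj', hzn]
        have hs0 : (s:ℂ) ≠ 0 := by exact_mod_cast hs.ne'
        rw [ha]
        simp only [map_div₀, map_neg, map_one, map_pow, hzz]
        push_cast
        field_simp
      have hna : ‖a‖ ^ 2 = 1 / s ^ 4 := by
        rw [ha, norm_div, norm_neg, norm_one, norm_pow, hzn]; ring
      have hPz : P z = ((‖a‖ ^ 2 + ‖b‖ ^ 2 : ℝ) : ℂ) + 2 * b * starRingEnd ℂ a
          + 2 * (starRingEnd ℂ b + starRingEnd ℂ a) * k z := by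
        simp only [hPdef]; rw [hca, hna]; ring
      rw [hPz]
      simp only [← Complex.normSq_eq_norm_sq, Complex.normSq_apply]
      simp
      nlinarith [sq_nonneg (k z).re, sq_nonneg (k z).im]

lemma aux_polar (F : ℂ → ENNReal) (hF : Measurable F) (r ρ : ℝ) (hr : 0 < r)
    (c : ℝ → ENNReal)
    (h : ∀ s ∈ Ioo r ρ, c s ≤ ∫⁻ θ in Ioo (-Real.pi) Real.pi, F (circleMap 0 s θ)) :
    ∫⁻ s in Ioo r ρ, ENNReal.ofReal s * c s ≤ ∫⁻ z in {z : ℂ | r < ‖z‖ ∧ ‖z‖ < ρ}, F z := by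
  have hA : MeasurableSet {z : ℂ | r < ‖z‖ ∧ ‖z‖ < ρ} :=
    (measurableSet_lt measurable_const measurable_norm).inter
      (measurableSet_lt measurable_norm measurable_const)
  rw [← lintegral_indicator hA, ← Complex.lintegral_comp_polarCoord_symm, polarCoord_target]
  have hpm : Measurable fun p : ℝ × ℝ => Complex.polarCoord.symm p := by
    have : Continuous fun p : ℝ × ℝ => Complex.polarCoord.symm p := by
      simp only [Complex.polarCoord_symm_apply]; fun_prop
    exact this.measurable
  rw [Measure.volume_eq_prod, ← Measure.prod_restrict, lintegral_prod]
  swap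
  · apply Measurable.aemeasurable
    exact (ENNReal.measurable_ofReal.comp measurable_fst).smul ((hF.indicator hA).comp hpm)
  have hsub : Ioo r ρ ⊆ Ioi 0 := fun x hx => hr.trans hx.1
  refine le_trans ?_ (lintegral_mono_set hsub)
  apply setLIntegral_mono' measurableSet_Ioo
  intro s hs
  have hs0 : 0 < s := hr.trans hs.1
  have hpt : ∀ θ, Complex.polarCoord.symm (s, θ) = circleMap 0 s θ := by
    intro θ
    simp [Complex.polarCoord_symm_apply, circleMap, Complex.exp_mul_I]
  simp only [hpt, smul_eq_mul]
  rw [lintegral_const_mul']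
  · gcongr
    refine (h s hs).trans (le_of_eq ?_)
    congr 1; ext θ
    rw [indicator_of_mem]
    simp [abs_of_pos hs0]; exact hs
  · simp

lemma aux_radial (r ρ B : ℝ) (hr : 0 < r) (hρ : r < ρ) :
    ENNReal.ofReal (Real.pi * ((1 / r ^ 2 - 1 / ρ ^ 2) + B ^ 2 * (ρ ^ 2 - r ^ 2))) ≤
    ∫⁻ s in Ioo r ρ, ENNReal.ofReal s * ENNReal.ofReal (2 * Real.pi * (1 / s ^ 4 + B ^ 2)) := by
  have hcont : ContinuousOn (fun s : ℝ => s * (2 * Real.pi * (1 / s ^ 4 + B ^ 2))) (Icc r ρ) := by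
    have : ∀ s ∈ Icc r ρ, s ^ 4 ≠ 0 := fun s hs => pow_ne_zero _ (hr.trans_le hs.1).ne'
    fun_prop (disch := assumption)
  have hint : ∫ s in r..ρ, s * (2 * Real.pi * (1 / s ^ 4 + B ^ 2)) =
      Real.pi * ((1 / r ^ 2 - 1 / ρ ^ 2) + B ^ 2 * (ρ ^ 2 - r ^ 2)) := by
    rw [intervalIntegral.integral_eq_sub_of_hasDerivAt
      (f := fun s => Real.pi * (- (s ^ 2)⁻¹ + B ^ 2 * s ^ 2))]
    · have hρ0 : ρ ≠ 0 := (hr.trans hρ).ne'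
      field_simp; ring
    · intro s hs
      rw [uIcc_of_le hρ.le] at hs
      have hs0 : s ≠ 0 := (hr.trans_le hs.1).ne'
      have h1 := ((((hasDerivAt_pow 2 s).inv (pow_ne_zero 2 hs0)).neg).add
        ((hasDerivAt_pow 2 s).const_mul (B ^ 2))).const_mul Real.pi
      convert! h1 using 1
      field_simp
      ring
    · apply ContinuousOn.intervalIntegrable
      rwa [uIcc_of_le hρ.le]
  rw [← hint, intervalIntegral.integral_of_le hρ.le, integral_Ioc_eq_integral_Ioo]
  refine (aux_ofReal _ _ (hcont.integrableOn_Icc.mono_set Ioo_subset_Icc_self)).trans ?_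
  apply setLIntegral_mono' measurableSet_Ioo
  intro s hs
  rw [ENNReal.ofReal_mul (hr.trans hs.1).le]

lemma aux_det (w : ℂ) : ((ContinuousLinearMap.restrictScalars ℝ
    (ContinuousLinearMap.toSpanSingleton ℂ w : ℂ →L[ℂ] ℂ))).det = ‖w‖ ^ 2 := by
  rw [ContinuousLinearMap.det, ← LinearMap.det_toMatrix Complex.basisOneI, Matrix.det_fin_two]
  simp [LinearMap.toMatrix_apply, ← Complex.normSq_eq_norm_sq, Complex.normSq_apply]

/-- The real linear map `w ↦ w - c * conj w`. -/
noncomputable def auxT (c : ℂ) : ℂ →ₗ[ℝ] ℂ :=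
  LinearMap.id - (LinearMap.mulLeft ℝ c).comp Complex.conjAe.toLinearMap

lemma auxT_apply (c w : ℂ) : auxT c w = w - c * starRingEnd ℂ w := by
  simp [auxT]

lemma auxT_det (c : ℂ) : LinearMap.det (auxT c) = 1 - ‖c‖ ^ 2 := by
  rw [← LinearMap.det_toMatrix Complex.basisOneI, Matrix.det_fin_two]
  simp [LinearMap.toMatrix_apply, auxT_apply, ← Complex.normSq_eq_norm_sq, Complex.normSq_apply]
  ring

/-- the geometric estimate: the image of the annulus is almost in an ellipse. -/
lemma aux_ellipse (b z R : ℂ) (r s C K : ℝ) (hr : 0 < r) (hrs : r ≤ s) (hs1 : s ≤ 1)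
    (hz : ‖z‖ = s) (hR : ‖R‖ ≤ C * s ^ 2) (hK : K = ‖b‖ ^ 2 + (1 + ‖b‖) * C) (hC : 0 ≤ C)
    (hrK : r * (2 * ‖b‖ + 2 * K) ≤ 1) :
    ‖auxT (b * (r:ℂ) ^ 2) (1 / z + (b * z + R))‖ ≤ 1 / r + K * r ^ 2 := by
  have hs : 0 < s := hr.trans_le hrs
  have hz0 : z ≠ 0 := by
    intro h; rw [h, norm_zero] at hz; linarith
  have hs0 : (s:ℂ) ≠ 0 := by exact_mod_cast hs.ne'
  have hzz : starRingEnd ℂ z = (s:ℂ) ^ 2 / z := by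
    rw [eq_div_iff hz0, mul_comm, Complex.mul_conj', hz]
  set B := ‖b‖ with hB
  have hB0 : 0 ≤ B := norm_nonneg _
  have hK0 : 0 ≤ K := by rw [hK]; positivity
  have hr2 : r ^ 2 ≤ 1 := by nlinarith
  have key : auxT (b * (r:ℂ) ^ 2) (1 / z + (b * z + R)) =
      1 / z + b * z * ((1 - r ^ 2 / s ^ 2 : ℝ) : ℂ)
       + (-(b * starRingEnd ℂ b * (r:ℂ) ^ 2 * starRingEnd ℂ z))
       + R + (-(b * (r:ℂ) ^ 2 * starRingEnd ℂ R)) := by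
    rw [auxT_apply]
    simp only [map_add, map_mul, map_div₀, map_one, hzz]
    push_cast
    field_simp
    ring
  have h0 : (0:ℝ) ≤ 1 - r ^ 2 / s ^ 2 := by
    rw [sub_nonneg, div_le_one (by positivity)]; gcongr
  have hr' : ‖(r:ℂ)‖ = r := by simp [abs_of_pos hr]
  have n1 : ‖auxT (b * (r:ℂ) ^ 2) (1 / z + (b * z + R))‖ ≤
      1 / s + B * s * (1 - r ^ 2 / s ^ 2) + B * B * r ^ 2 * s + ‖R‖ + B * r ^ 2 * ‖R‖ := by
    rw [key]
    refine (norm_add_le _ _).trans (add_le_add ((norm_add_le _ _).trans (add_le_add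
      ((norm_add_le _ _).trans (add_le_add ((norm_add_le _ _).trans (add_le_add ?_ ?_)) ?_)) le_rfl)) ?_)
    · simp [hz]
    · rw [norm_mul, norm_mul, hz, Complex.norm_real, Real.norm_of_nonneg h0]
    · simp [hz, hr', hB]
    · simp [hr', hB]
  have n2 : B * B * r ^ 2 * s ≤ B ^ 2 * s ^ 2 := by
    have : r ^ 2 * s ≤ s ^ 2 := by nlinarith
    nlinarith [mul_nonneg hB0 hB0]
  have n3 : B * r ^ 2 * ‖R‖ ≤ B * (C * s ^ 2) := by
    have : B * r ^ 2 ≤ B := by nlinarith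
    exact mul_le_mul this hR (norm_nonneg _) hB0
  have n4 : 1 / s + B * s * (1 - r ^ 2 / s ^ 2) + K * s ^ 2 ≤ 1 / r + K * r ^ 2 := by
    have e : 1 / r + K * r ^ 2 - (1 / s + B * s * (1 - r ^ 2 / s ^ 2) + K * s ^ 2) =
       (s - r) * (1 - (B * (s + r) * r + K * (s + r) * s * r)) / (s * r) := by
      field_simp; ring
    have : B * (s + r) * r + K * (s + r) * s * r ≤ 1 := by
      have h1 : B * (s + r) * r ≤ B * 2 * r := by gcongr; linarith
      have h2 : K * (s + r) * s * r ≤ K * 2 * 1 * r := by gcongr; linarith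
      linarith
    have : 0 ≤ (s - r) * (1 - (B * (s + r) * r + K * (s + r) * s * r)) / (s * r) := by
      apply div_nonneg (mul_nonneg _ _) <;> first | positivity | linarith
    linarith
  rw [hK] at n4 ⊢
  nlinarith

lemma area_ineq (v : ℂ → ℂ) (hv : DifferentiableOn ℂ v (ball 0 1)) (hv0 : v 0 = 0)
    (hinj : InjOn (fun z => 1 / z + v z) (ball 0 1 \ {0})) (r ρ C K : ℝ) (hr : 0 < r) (hrρ : r < ρ)
    (hρ : ρ < 1) (hC : 0 ≤ C) (hCv : ∀ z, ‖z‖ ≤ ρ → ‖v z - deriv v 0 * z‖ ≤ C * ‖z‖ ^ 2)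
    (hK : K = ‖deriv v 0‖ ^ 2 + (1 + ‖deriv v 0‖) * C)
    (hrK : r * (2 * ‖deriv v 0‖ + 2 * K) ≤ 1) :
    (1 - ‖deriv v 0‖ ^ 2 * r ^ 4) *
      ((1 / r ^ 2 - 1 / ρ ^ 2) + ‖deriv v 0‖ ^ 2 * (ρ ^ 2 - r ^ 2)) ≤ (1 / r + K * r ^ 2) ^ 2 := by
  set b := deriv v 0 with hb
  set A : Set ℂ := {z : ℂ | r < ‖z‖ ∧ ‖z‖ < ρ} with hA
  set G : ℂ → ℂ := fun z => 1 / z + v z with hG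
  have hAm : MeasurableSet A :=
    (measurableSet_lt measurable_const measurable_norm).inter
      (measurableSet_lt measurable_norm measurable_const)
  have hvd : DifferentiableOn ℂ (deriv v) (ball 0 1) := hv.deriv isOpen_ball
  have hGd : ∀ z, z ≠ 0 → ‖z‖ < 1 → HasDerivAt G (-1 / z ^ 2 + b + (deriv v z - b)) z := by
    intro z hz hz1
    have h1 : HasDerivAt v (deriv v z) z :=
      (hv.differentiableAt (isOpen_ball.mem_nhds (by simpa using hz1))).hasDerivAt
    have h2 := (hasDerivAt_inv hz).add h1
    have : G = (fun y => y⁻¹) + v := by ext; simp [hG]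
    rw [this]
    convert! h2 using 1
    ring
  have hAne : ∀ z ∈ A, z ≠ 0 ∧ ‖z‖ < 1 := by
    intro z hz
    exact ⟨norm_pos_iff.mp (hr.trans hz.1), hz.2.trans hρ⟩
  have hlow : ENNReal.ofReal (Real.pi * ((1 / r ^ 2 - 1 / ρ ^ 2) + ‖b‖ ^ 2 * (ρ ^ 2 - r ^ 2))) ≤
      volume (G '' A) := by
    rw [← lintegral_abs_det_fderiv_eq_addHaar_image volume hAm
      (f' := fun z => ContinuousLinearMap.restrictScalars ℝ
        (ContinuousLinearMap.toSpanSingleton ℂ (deriv G z) : ℂ →L[ℂ] ℂ))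
      (fun z hz => by
        have := (hGd z (hAne z hz).1 (hAne z hz).2).differentiableAt.hasDerivAt.hasFDerivAt
        exact (this.restrictScalars ℝ).hasFDerivWithinAt)
      (hinj.mono (fun z (hz : z ∈ A) =>
        (⟨by simpa using (hAne z hz).2, (hAne z hz).1⟩ : z ∈ ball (0:ℂ) 1 \ {0})))]
    simp only [aux_det, abs_of_nonneg (sq_nonneg ‖deriv G _‖)]
    refine (aux_radial r ρ ‖b‖ hr hrρ).trans ?_
    apply aux_polar (fun z => ENNReal.ofReal (‖deriv G z‖ ^ 2)) ?_ r ρ hr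
    · intro s hs
      have hs0 : 0 < s := hr.trans hs.1
      have hs1 : s < 1 := hs.2.trans hρ
      apply aux_inner (fun z => deriv v z - b) b s hs0 ?_ (by simp [hb])
      · intro z hz
        exact (hGd z (norm_pos_iff.mp (by rw [hz]; exact hs0)) (by rw [hz]; exact hs1)).deriv
      · apply DifferentiableOn.diffContOnCl
        rw [closure_ball _ hs0.ne']
        exact (hvd.sub_const b).mono (closedBall_subset_ball hs1)
    · exact ENNReal.measurable_ofReal.comp ((measurable_deriv G).norm.pow_const 2)
  set c : ℂ := b * (r:ℂ) ^ 2 with hc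
  have hcn : ‖c‖ ^ 2 = ‖b‖ ^ 2 * r ^ 4 := by
    rw [hc, norm_mul, norm_pow, Complex.norm_real, Real.norm_of_nonneg hr.le]; ring
  have hK0 : 0 ≤ K := by rw [hK]; positivity
  have hdet : 0 < 1 - ‖c‖ ^ 2 := by
    rw [hcn]
    have h1 : r * ‖b‖ ≤ 1 / 2 := by nlinarith [mul_nonneg hr.le hK0]
    have h2 : r * ‖b‖ * r ≤ 1 / 2 := by
      have := mul_nonneg hr.le (norm_nonneg b); nlinarith
    have h3 : 0 ≤ r * ‖b‖ * r := by positivity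
    have : ‖b‖ ^ 2 * r ^ 4 = (r * ‖b‖ * r) ^ 2 := by ring
    rw [this]; nlinarith
  have hsub : G '' A ⊆ auxT c ⁻¹' closedBall 0 (1 / r + K * r ^ 2) := by
    rintro _ ⟨z, hz, rfl⟩
    rw [mem_preimage, mem_closedBall_zero_iff]
    have := aux_ellipse b z (v z - b * z) r ‖z‖ C K hr hz.1.le (hz.2.trans hρ).le rfl
      (hCv z hz.2.le) hK hC hrK
    simpa [hG] using this
  have hup := measure_mono (μ := volume) hsub
  rw [Measure.addHaar_preimage_linearMap volume (by rw [auxT_det]; exact hdet.ne'), auxT_det,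
    Complex.volume_closedBall, abs_of_pos (inv_pos.mpr hdet)] at hup
  have h := hlow.trans hup
  have hR0 : 0 ≤ 1 / r + K * r ^ 2 := by positivity
  have e : ENNReal.ofReal (1 - ‖c‖ ^ 2)⁻¹ * (ENNReal.ofReal (1 / r + K * r ^ 2) ^ 2 * NNReal.pi)
     = ENNReal.ofReal ((1 - ‖c‖ ^ 2)⁻¹ * ((1 / r + K * r ^ 2) ^ 2 * Real.pi)) := by
    rw [ENNReal.ofReal_mul (inv_nonneg.mpr hdet.le), ENNReal.ofReal_mul (by positivity),
      ENNReal.ofReal_pow hR0]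
    congr 2
    rw [← NNReal.coe_real_pi, ENNReal.ofReal_coe_nnreal]
  rw [e, ENNReal.ofReal_le_ofReal_iff (by positivity)] at h
  rw [← hcn]
  have hpi := Real.pi_pos
  have h' : ((1 / r ^ 2 - 1 / ρ ^ 2) + ‖b‖ ^ 2 * (ρ ^ 2 - r ^ 2)) ≤ (1 - ‖c‖ ^ 2)⁻¹ * (1 / r + K * r ^ 2) ^ 2 := by
    have : Real.pi * ((1 / r ^ 2 - 1 / ρ ^ 2) + ‖b‖ ^ 2 * (ρ ^ 2 - r ^ 2)) ≤
      Real.pi * ((1 - ‖c‖ ^ 2)⁻¹ * (1 / r + K * r ^ 2) ^ 2) := by linarith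
    exact le_of_mul_le_mul_left this hpi
  rw [inv_mul_eq_div, le_div_iff₀ hdet] at h'
  linarith

/-- **Gronwall's area theorem** (first coefficient). -/
lemma area_thm (v : ℂ → ℂ) (hv : DifferentiableOn ℂ v (ball 0 1)) (hv0 : v 0 = 0)
    (hinj : InjOn (fun z => 1 / z + v z) (ball 0 1 \ {0})) : ‖deriv v 0‖ ≤ 1 := by
  set B := ‖deriv v 0‖ with hB
  have hB0 : 0 ≤ B := norm_nonneg _
  have main : ∀ ρ : ℝ, 0 < ρ → ρ < 1 → B * ρ ^ 2 ≤ 1 := by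
    intro ρ hρ0 hρ1
    have hn : ball (0:ℂ) 1 ∈ 𝓝 (0:ℂ) := ball_mem_nhds _ one_pos
    set e := dslope (dslope v 0) 0 with he
    have hed : DifferentiableOn ℂ e (ball 0 1) :=
      (Complex.differentiableOn_dslope hn).2 ((Complex.differentiableOn_dslope hn).2 hv)
    have hve : ∀ z, v z - deriv v 0 * z = z ^ 2 * e z := by
      intro z
      have h1 := sub_smul_dslope v 0 z
      have h2 := sub_smul_dslope (dslope v 0) 0 z
      rw [dslope_same] at h2
      simp only [sub_zero, smul_eq_mul, hv0] at h1 h2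
      rw [← h1, pow_two, mul_assoc, he, h2]; ring
    obtain ⟨C, hC⟩ := (isCompact_closedBall (0:ℂ) ρ).exists_bound_of_continuousOn
      (hed.continuousOn.mono (closedBall_subset_ball hρ1))
    have hC0 : 0 ≤ C := (norm_nonneg _).trans (hC 0 (by simp [hρ0.le]))
    set K := B ^ 2 + (1 + B) * C with hK
    have hCv : ∀ z, ‖z‖ ≤ ρ → ‖v z - deriv v 0 * z‖ ≤ C * ‖z‖ ^ 2 := by
      intro z hz
      rw [hve, norm_mul, norm_pow, mul_comm]
      gcongr
      exact hC z (by simpa using hz)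
    have hK0 : 0 ≤ K := by positivity
    have ev : ∀ᶠ r in 𝓝[>] (0:ℝ), -1 / ρ ^ 2 + B ^ 2 * (ρ ^ 2 - r ^ 2) -
        (2 * K * r + K ^ 2 * r ^ 4 + B ^ 2 * r ^ 2 + B ^ 2 * r ^ 4 * (B ^ 2 * ρ ^ 2)) ≤ 0 := by
      have h1 : ∀ᶠ r in 𝓝[>] (0:ℝ), r < ρ := by
        exact nhdsWithin_le_nhds (eventually_lt_nhds hρ0)
      have h2 : ∀ᶠ r in 𝓝[>] (0:ℝ), r * (2 * B + 2 * K) < 1 := by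
        apply nhdsWithin_le_nhds
        have : Continuous fun r : ℝ => r * (2 * B + 2 * K) := by fun_prop
        exact this.continuousAt.eventually_lt continuousAt_const (by simp)
      filter_upwards [h1, h2, self_mem_nhdsWithin] with r hr1 hr2 hr
      have hr : 0 < r := hr
      have := area_ineq v hv hv0 hinj r ρ C K hr hr1 hρ1 hC0 hCv hK hr2.le
      rw [← hB] at this
      have e1 : (1 - B ^ 2 * r ^ 4) * ((1 / r ^ 2 - 1 / ρ ^ 2) + B ^ 2 * (ρ ^ 2 - r ^ 2)) =
         1 / r ^ 2 - 1 / ρ ^ 2 + B ^ 2 * (ρ ^ 2 - r ^ 2) - B ^ 2 * r ^ 2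
           + B ^ 2 * r ^ 4 * (1 / ρ ^ 2) - B ^ 2 * r ^ 4 * (B ^ 2 * (ρ ^ 2 - r ^ 2)) := by
        field_simp
        ring
      have e2 : (1 / r + K * r ^ 2) ^ 2 = 1 / r ^ 2 + 2 * K * r + K ^ 2 * r ^ 4 := by
        field_simp
        ring
      rw [e1, e2] at this
      have p1 : 0 ≤ B ^ 2 * r ^ 4 * (1 / ρ ^ 2) := by positivity
      have p2 : 0 ≤ B ^ 2 * r ^ 4 * (B ^ 2 * r ^ 2) := by positivity
      have e3 : -1 / ρ ^ 2 = - (1 / ρ ^ 2) := by ring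
      rw [e3]
      nlinarith
    have lim : Filter.Tendsto (fun r : ℝ => -1 / ρ ^ 2 + B ^ 2 * (ρ ^ 2 - r ^ 2) -
        (2 * K * r + K ^ 2 * r ^ 4 + B ^ 2 * r ^ 2 + B ^ 2 * r ^ 4 * (B ^ 2 * ρ ^ 2)))
        (𝓝[>] 0) (𝓝 (-1 / ρ ^ 2 + B ^ 2 * ρ ^ 2)) := by
      apply tendsto_nhdsWithin_of_tendsto_nhds
      have : Continuous (fun r : ℝ => -1 / ρ ^ 2 + B ^ 2 * (ρ ^ 2 - r ^ 2) -
        (2 * K * r + K ^ 2 * r ^ 4 + B ^ 2 * r ^ 2 + B ^ 2 * r ^ 4 * (B ^ 2 * ρ ^ 2))) := by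
        fun_prop
      have := this.tendsto 0
      simpa using this
    have fin := le_of_tendsto lim ev
    have : B ^ 2 * ρ ^ 2 ≤ 1 / ρ ^ 2 := by
      have e3 : -1 / ρ ^ 2 = - (1 / ρ ^ 2) := by ring
      rw [e3] at fin; linarith
    rw [le_div_iff₀ (by positivity)] at this
    have h0 : 0 ≤ B * ρ ^ 2 := by positivity
    nlinarith
  have lim : Filter.Tendsto (fun ρ : ℝ => B * ρ ^ 2) (𝓝[<] 1) (𝓝 B) := by
    apply tendsto_nhdsWithin_of_tendsto_nhds
    have : Continuous (fun ρ : ℝ => B * ρ ^ 2) := by fun_prop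
    simpa using this.tendsto 1
  apply le_of_tendsto lim
  have h1 : ∀ᶠ r in 𝓝[<] (1:ℝ), 0 < r := nhdsWithin_le_nhds (eventually_gt_nhds one_pos)
  filter_upwards [h1, self_mem_nhdsWithin] with r hr hr1 using main r hr hr1

/-- holomorphic inverse square root on the disc. -/
lemma exists_inv_sqrt (φ : ℂ → ℂ) (hφ : DifferentiableOn ℂ φ (ball 0 1))
    (h0 : φ 0 = 1) (hne : ∀ z ∈ ball (0:ℂ) 1, φ z ≠ 0) :
    ∃ q : ℂ → ℂ, DifferentiableOn ℂ q (ball 0 1) ∧ q 0 = 1 ∧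
      (∀ z ∈ ball (0:ℂ) 1, q z ^ 2 * φ z = 1) ∧ deriv q 0 = - deriv φ 0 / 2 := by
  have hd : DifferentiableOn ℂ (fun z => deriv φ z / φ z) (ball 0 1) :=
    (hφ.deriv isOpen_ball).div hφ hne
  obtain ⟨L, hL0, hL⟩ := hd.isExactOn_ball.with_val_at 0 0
  have hφd : ∀ z ∈ ball (0:ℂ) 1, HasDerivAt φ (deriv φ z) z := fun z hz =>
    (hφ.differentiableAt (isOpen_ball.mem_nhds hz)).hasDerivAt
  have hq : ∀ z ∈ ball (0:ℂ) 1, HasDerivAt (fun z => Complex.exp (-L z / 2))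
      (Complex.exp (-L z / 2) * (-(deriv φ z / φ z) / 2)) z := fun z hz =>
    (((hL z hz).neg).div_const 2).cexp
  have h00 : (0:ℂ) ∈ ball (0:ℂ) 1 := by simp
  refine ⟨fun z => Complex.exp (-L z / 2), fun z hz => (hq z hz).differentiableAt.differentiableWithinAt,
    by simp [hL0], ?_, ?_⟩
  · have hder : ∀ z ∈ ball (0:ℂ) 1, HasDerivAt (fun z => Complex.exp (-L z / 2) ^ 2 * φ z) 0 z := by
      intro z hz
      have := ((hq z hz).pow 2).mul (hφd z hz)
      convert! this using 1
      have := hne z hz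
      simp only [Pi.pow_apply]
      field_simp
      ring
    intro z hz
    have := (isOpen_ball (x := (0:ℂ)) (ε := 1)).is_const_of_deriv_eq_zero
      (convex_ball (0:ℂ) 1).isPreconnected (f := fun z => Complex.exp (-L z / 2) ^ 2 * φ z)
      (fun z hz => (hder z hz).differentiableAt.differentiableWithinAt)
      (fun z hz => (hder z hz).deriv) hz h00
    simpa [hL0, h0] using this
  · rw [(hq 0 h00).deriv]; simp [hL0, h0]

/-- **Bieberbach**: second coefficient. -/
lemma bieberbach (φ : ℂ → ℂ) (hφ : DifferentiableOn ℂ φ (ball 0 1))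
    (h0 : φ 0 = 1) (hinj : InjOn (fun z => z * φ z) (ball 0 1)) : ‖deriv φ 0‖ ≤ 2 := by
  have h00 : (0:ℂ) ∈ ball (0:ℂ) 1 := by simp
  have hne : ∀ z ∈ ball (0:ℂ) 1, φ z ≠ 0 := by
    intro z hz h
    have : z = 0 := hinj hz h00 (by simp [h])
    rw [this, h0] at h; exact one_ne_zero h
  obtain ⟨q, hq, hq0, hqφ, hq'⟩ := exists_inv_sqrt φ hφ h0 hne
  set p := dslope q 0 with hp
  have hn : ball (0:ℂ) 1 ∈ 𝓝 (0:ℂ) := ball_mem_nhds _ one_pos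
  have hpd : DifferentiableOn ℂ p (ball 0 1) := (Complex.differentiableOn_dslope hn).2 hq
  have hqp : ∀ z, q z = 1 + z * p z := by
    intro z
    have h1 := sub_smul_dslope q 0 z
    simp only [sub_zero, smul_eq_mul, hq0] at h1
    rw [hp, h1]; ring
  have hsq : ∀ z ∈ ball (0:ℂ) 1, z ^ 2 ∈ ball (0:ℂ) 1 := by
    intro z hz
    rw [mem_ball_zero_iff] at hz ⊢
    rw [norm_pow]
    exact pow_lt_one₀ (norm_nonneg _) hz two_ne_zero
  have hp2 : DifferentiableOn ℂ (fun z => p (z ^ 2)) (ball 0 1) :=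
    hpd.comp (by fun_prop) hsq
  have hv : DifferentiableOn ℂ (fun z => z * p (z ^ 2)) (ball 0 1) := differentiableOn_id.mul hp2
  have hdv : deriv (fun z => z * p (z ^ 2)) 0 = deriv q 0 := by
    have h1 : HasDerivAt (fun z => p (z ^ 2)) (deriv (fun z => p (z ^ 2)) 0) 0 :=
      (hp2.differentiableAt hn).hasDerivAt
    have := (hasDerivAt_id (0:ℂ)).mul h1
    have h3 := this.deriv
    have e : (id * fun z => p (z ^ 2)) = fun z => z * p (z ^ 2) := by ext; simp
    rw [e] at h3
    rw [h3]; simp [hp]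
  have harea := area_thm (fun z => z * p (z ^ 2)) hv (by simp) (by
    have hG : ∀ z : ℂ, z ≠ 0 → 1 / z + z * p (z ^ 2) = q (z ^ 2) / z := by
      intro z hz
      rw [hqp]; field_simp
    have hG2 : ∀ z : ℂ, z ∈ ball (0:ℂ) 1 → z ≠ 0 → (q (z ^ 2) / z) ^ 2 = (z ^ 2 * φ (z ^ 2))⁻¹ := by
      intro z hz hz0
      have h1 := hqφ _ (hsq z hz)
      have h2 := hne _ (hsq z hz)
      rw [eq_comm, inv_eq_iff_eq_inv, ← inv_pow, inv_div, div_pow, eq_div_iff]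
      · linear_combination z ^ 2 * h1
      · intro h; rw [h] at h1; simp at h1
    rintro z ⟨hz, hz0⟩ w ⟨hw, hw0⟩ hzw
    simp only [mem_singleton_iff] at hz0 hw0
    simp only at hzw
    rw [hG z hz0, hG w hw0] at hzw
    have h1 : (z ^ 2 * φ (z ^ 2))⁻¹ = (w ^ 2 * φ (w ^ 2))⁻¹ := by
      rw [← hG2 z hz hz0, ← hG2 w hw hw0, hzw]
    have h2 : z ^ 2 = w ^ 2 := hinj (hsq z hz) (hsq w hw) (inv_injective h1)
    rcases sq_eq_sq_iff_eq_or_eq_neg.mp h2 with h | h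
    · exact h
    · exfalso
      rw [h2, h, div_neg, neg_eq_iff_add_eq_zero, ← two_mul] at hzw
      have h3 : q (w ^ 2) = 0 := by
        rcases mul_eq_zero.mp hzw with h | h
        · norm_num at h
        · exact (div_eq_zero_iff.mp h).resolve_right hw0
      have := hqφ _ (hsq w hw)
      rw [h3] at this; simp at this)
  rw [hdv, hq', norm_div, norm_neg] at harea
  simp at harea
  linarith

lemma koebe_unit (φ : ℂ → ℂ) (hφ : DifferentiableOn ℂ φ (ball 0 1))
    (h0 : φ 0 = 1) (hinj : InjOn (fun z => z * φ z) (ball 0 1)) (w : ℂ)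
    (hw : ∀ z ∈ ball (0:ℂ) 1, z * φ z ≠ w) : 1 / 4 ≤ ‖w‖ := by
  have h00 : (0:ℂ) ∈ ball (0:ℂ) 1 := by simp
  have hn : ball (0:ℂ) 1 ∈ 𝓝 (0:ℂ) := ball_mem_nhds _ one_pos
  have hw0 : w ≠ 0 := fun h => hw 0 h00 (by simp [h])
  have hb1 := bieberbach φ hφ h0 hinj
  have hne : ∀ z ∈ ball (0:ℂ) 1, w - z * φ z ≠ 0 := fun z hz h => hw z hz (sub_eq_zero.mp h).symm
  have hden : DifferentiableOn ℂ (fun z => w - z * φ z) (ball 0 1) :=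
    (differentiableOn_const w).sub (differentiableOn_id.mul hφ)
  have hb2 := bieberbach (fun z => w * φ z / (w - z * φ z))
    (((differentiableOn_const w).mul hφ).div hden hne) (by simp [h0, hw0]) (by
      intro a ha b hb hab
      have h1 := hne a ha
      have h2 := hne b hb
      apply hinj ha hb
      simp only at hab ⊢
      field_simp at hab
      have : w * (a * φ a) = w * (b * φ b) := by linear_combination hab
      exact mul_left_cancel₀ hw0 this)
  have hd : deriv (fun z => w * φ z / (w - z * φ z)) 0 = deriv φ 0 + 1 / w := by
    have h1 : HasDerivAt φ (deriv φ 0) 0 := (hφ.differentiableAt hn).hasDerivAt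
    have h2 := (h1.const_mul w).div (((hasDerivAt_id (0:ℂ)).mul h1).const_sub w) (hne 0 h00)
    refine h2.deriv.trans ?_
    simp [h0]
    field_simp
    
  rw [hd] at hb2
  have h3 : ‖(1:ℂ) / w‖ ≤ 4 := by
    have : (1:ℂ) / w = (deriv φ 0 + 1 / w) - deriv φ 0 := by ring
    rw [this]
    refine (norm_sub_le _ _).trans (by linarith)
  rw [norm_div, norm_one, div_le_iff₀ (norm_pos_iff.mpr hw0)] at h3
  linarith

/-- **Koebe one-quarter theorem**. -/
lemma koebe (f : ℂ → ℂ) (c : ℂ) (R : ℝ) (hR : 0 < R) (hf : DifferentiableOn ℂ f (ball c R))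
    (hinj : InjOn f (ball c R)) (w : ℂ) (hw : ∀ z ∈ ball c R, f z ≠ w) :
    ‖deriv f c‖ * R / 4 ≤ ‖w - f c‖ := by
  by_cases hd : deriv f c = 0
  · simp [hd]
  have hn : ball (0:ℂ) 1 ∈ 𝓝 (0:ℂ) := ball_mem_nhds _ one_pos
  have hRc : (R:ℂ) ≠ 0 := by exact_mod_cast hR.ne'
  set a : ℂ := R * deriv f c with ha
  have ha0 : a ≠ 0 := mul_ne_zero hRc hd
  set F : ℂ → ℂ := fun z => (f (c + R * z) - f c) / a with hF
  have hmap : ∀ z ∈ ball (0:ℂ) 1, c + R * z ∈ ball c R := by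
    intro z hz
    rw [mem_ball_zero_iff] at hz
    rw [mem_ball, dist_eq_norm, add_sub_cancel_left, norm_mul, Complex.norm_real,
      Real.norm_of_nonneg hR.le]
    nlinarith
  have hFd : DifferentiableOn ℂ F (ball 0 1) :=
    ((hf.comp (t := ball c R) (f := fun z : ℂ => c + R * z) (by fun_prop) hmap).sub_const _).div_const _
  have hF0 : F 0 = 0 := by simp [hF]
  have hF1 : deriv F 0 = 1 := by
    have h1 : HasDerivAt f (deriv f c) (c + R * 0) := by
      rw [mul_zero, add_zero]
      exact (hf.differentiableAt (ball_mem_nhds c hR)).hasDerivAt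
    have h2 : HasDerivAt (fun z : ℂ => c + R * z) (R * 1) 0 :=
      ((hasDerivAt_id (0:ℂ)).const_mul (R:ℂ)).const_add c
    have h3 := ((h1.comp 0 h2).sub_const (f c)).div_const a
    refine h3.deriv.trans ?_
    rw [ha]; field_simp
  set φ := dslope F 0 with hφ
  have hFφ : ∀ z, z * φ z = F z := by
    intro z
    have h1 := sub_smul_dslope F 0 z
    simpa [hF0] using h1
  have hk := koebe_unit φ ((Complex.differentiableOn_dslope hn).2 hFd) (by simp [hφ, hF1])
    (by
      simp only [hFφ]
      intro x hx y hy hxy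
      simp only [hF, div_left_inj' ha0, sub_left_inj] at hxy
      have := hinj (hmap x hx) (hmap y hy) hxy
      simpa [hRc] using this) ((w - f c) / a) (by
      intro z hz h
      rw [hFφ] at h
      simp only [hF, div_left_inj' ha0, sub_left_inj] at h
      exact hw _ (hmap z hz) h)
  rw [norm_div, le_div_iff₀ (norm_pos_iff.mpr ha0), ha, norm_mul, Complex.norm_real,
      Real.norm_of_nonneg hR.le] at hk
  linarith

/-- The inverse of an injective holomorphic map is holomorphic. -/
lemma inverse_holo (D : Set ℂ) (hD : IsOpen D) (hDc : IsPreconnected D) (f g : ℂ → ℂ)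
    (hf : DifferentiableOn ℂ f D) (hinj : InjOn f D) (hgf : ∀ x ∈ D, g (f x) = x) :
    DifferentiableOn ℂ g (f '' D) := by
  rcases D.eq_empty_or_nonempty with rfl | hne
  · simp [DifferentiableOn]
  have han : AnalyticOnNhd ℂ f D := hf.analyticOnNhd hD
  -- no constancy on a small neighborhood
  have hnc : ∀ x ∈ D, ¬ ∀ᶠ z in 𝓝 x, f z = f x := by
    intro x hx h
    have h1 : ∀ᶠ z in 𝓝[≠] x, z = x := by
      filter_upwards [nhdsWithin_le_nhds h, nhdsWithin_le_nhds (hD.mem_nhds hx)] with z hz hzD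
      exact hinj hzD hx hz
    have h2 : ∀ᶠ z in 𝓝[≠] x, False := by
      filter_upwards [h1, self_mem_nhdsWithin] with z hz hz' using hz' hz
    rw [Filter.eventually_false_iff_eq_bot] at h2
    exact (Filter.NeBot.ne inferInstance) h2
  have hop : ∀ s ⊆ D, IsOpen s → IsOpen (f '' s) := by
    refine (han.is_constant_or_isOpen hDc).resolve_left ?_
    rintro ⟨w, hw⟩
    obtain ⟨x, hx⟩ := hne
    exact hnc x hx (by filter_upwards [hD.mem_nhds hx] with z hz; rw [hw z hz, hw x hx])
  have hgc : ∀ x ∈ D, ContinuousAt g (f x) := by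
    intro x hx
    rw [ContinuousAt, hgf x hx]
    intro U hU
    obtain ⟨V, hVU, hVo, hxV⟩ := _root_.mem_nhds_iff.mp (Filter.inter_mem hU (hD.mem_nhds hx))
    have : f '' V ∈ 𝓝 (f x) := (hop V (fun z hz => (hVU hz).2) hVo).mem_nhds ⟨x, hxV, rfl⟩
    rw [Filter.mem_map]
    filter_upwards [this]
    rintro _ ⟨z, hz, rfl⟩
    rw [mem_preimage, hgf z (hVU hz).2]
    exact (hVU hz).1
  have hfo : IsOpen (f '' D) := hop D subset_rfl hD
  have hgd : ∀ x ∈ D, deriv f x ≠ 0 → DifferentiableAt ℂ g (f x) := by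
    intro x hx hd
    have h1 : HasDerivAt f (deriv f x) (g (f x)) := by
      rw [hgf x hx]
      exact (hf.differentiableAt (hD.mem_nhds hx)).hasDerivAt
    refine (HasDerivAt.of_local_left_inverse (hgc x hx) h1 hd ?_).differentiableAt
    filter_upwards [hfo.mem_nhds ⟨x, hx, rfl⟩]
    rintro _ ⟨z, hz, rfl⟩
    rw [hgf z hz]
  rintro _ ⟨x, hx, rfl⟩
  apply DifferentiableAt.differentiableWithinAt
  apply AnalyticAt.differentiableAt
  apply Complex.analyticAt_of_differentiable_on_punctured_nhds_of_continuousAt _ (hgc x hx)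
  rcases (han x hx).deriv.eventually_eq_zero_or_eventually_ne_zero with h | h
  · exfalso
    apply hnc x hx
    obtain ⟨ε, hε, hb⟩ := Metric.mem_nhds_iff.mp (Filter.inter_mem h (hD.mem_nhds hx))
    filter_upwards [ball_mem_nhds x hε] with z hz
    exact isOpen_ball.is_const_of_deriv_eq_zero (convex_ball x ε).isPreconnected
      (hf.mono fun y hy => (hb hy).2) (fun y hy => (hb hy).1) hz (mem_ball_self hε)
  · have h' : ∀ᶠ z in 𝓝 x, z ≠ x → deriv f z ≠ 0 := eventually_nhdsWithin_iff.mp h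
    have hgc' : Filter.Tendsto g (𝓝 (f x)) (𝓝 x) := by
      have := hgc x hx
      rwa [ContinuousAt, hgf x hx] at this
    rw [eventually_nhdsWithin_iff]
    filter_upwards [hgc'.eventually h', hfo.mem_nhds ⟨x, hx, rfl⟩]
    rintro _ h1 ⟨z, hz, rfl⟩ hne
    rw [hgf z hz] at h1
    exact hgd z hz (h1 (by rintro rfl; exact hne rfl))


lemma ball_bdist_subset (D : Set ℂ) (hD : IsOpen D) (z : ℂ) (hz : z ∈ D) (hpos : 0 < bdist D z) :
    ball z (bdist D z) ⊆ D := by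
  refine (convex_ball z _).isPreconnected.subset_of_closure_inter_subset hD
    ⟨z, mem_ball_self hpos, hz⟩ ?_
  rintro y ⟨hy1, hy2⟩
  by_contra hy
  have : y ∈ frontier D := by rw [hD.frontier_eq]; exact ⟨hy1, hy⟩
  exact (Set.disjoint_left.mp (disjoint_ball_infDist (x := z) (s := frontier D))) hy2 this

lemma bdist_pos (D : Set ℂ) (hD : IsOpen D) (hDp : D ≠ Set.univ) (z : ℂ) (hz : z ∈ D) :
    0 < bdist D z := by
  have hne : (frontier D).Nonempty := nonempty_frontier_iff.mpr ⟨⟨z, hz⟩, hDp⟩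
  refine (isClosed_frontier.notMem_iff_infDist_pos hne).mp ?_
  rw [hD.frontier_eq]
  exact fun h => h.2 hz

lemma two_bdist_le (D : Set ℂ) (hD : IsOpen D) (hDb : Bornology.IsBounded D)
    (hDp : D ≠ Set.univ) (z : ℂ) (hz : z ∈ D) : 2 * bdist D z ≤ diam D := by
  have hp := bdist_pos D hD hDp z hz
  rw [← Metric.diam_ball_eq z hp.le]
  exact diam_mono (ball_bdist_subset D hD z hz hp) hDb

lemma mDensity_bounds (D : Set ℂ) (hD : IsOpen D) (hDb : Bornology.IsBounded D)
    (hDp : D ≠ Set.univ) (z : ℂ) (hz : z ∈ D) :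
    1 / bdist D z ≤ mDensity D z ∧ mDensity D z ≤ 2 / bdist D z := by
  have hp := bdist_pos D hD hDp z hz
  have h2 := two_bdist_le D hD hDb hDp z hz
  unfold mDensity
  set δ := bdist D z
  set d := diam D
  have h3 : 0 < d - δ := by linarith
  constructor
  · rw [div_le_div_iff₀ hp (by positivity)]
    nlinarith
  · rw [div_le_div_iff₀ (by positivity) hp]
    nlinarith

lemma mDensity_continuousOn (D : Set ℂ) (hD : IsOpen D) (hDb : Bornology.IsBounded D)
    (hDp : D ≠ Set.univ) : ContinuousOn (mDensity D) D := by
  unfold mDensity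
  have hc : Continuous (bdist D) := continuous_infDist_pt (frontier D)
  apply ContinuousOn.div continuousOn_const (by fun_prop)
  intro z hz
  have hp := bdist_pos D hD hDp z hz
  have h2 := two_bdist_le D hD hDb hDp z hz
  have h3 : 0 < diam D - bdist D z := by linarith
  positivity

lemma mDensity_nonneg (D : Set ℂ) (hD : IsOpen D) (hDb : Bornology.IsBounded D)
    (hDp : D ≠ Set.univ) (z : ℂ) (hz : z ∈ D) : 0 ≤ mDensity D z :=
  le_trans (by have := bdist_pos D hD hDp z hz; positivity) (mDensity_bounds D hD hDb hDp z hz).1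


/-- The infinitesimal inequality. -/
lemma mDensity_conformal (D D' : Set ℂ) (hD : IsOpen D) (hDb : Bornology.IsBounded D)
    (hDp : D ≠ Set.univ) (hD' : IsOpen D') (hD'b : Bornology.IsBounded D')
    (hD'p : D' ≠ Set.univ) (f : ℂ → ℂ) (hf : DifferentiableOn ℂ f D) (hinj : InjOn f D)
    (hfm : MapsTo f D D') (z : ℂ) (hz : z ∈ D) :
    mDensity D' (f z) * ‖deriv f z‖ ≤ 8 * mDensity D z := by
  have hp := bdist_pos D hD hDp z hz
  have hp' := bdist_pos D' hD' hD'p (f z) (hfm hz)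
  have hsub := ball_bdist_subset D hD z hz hp
  have hne : (frontier D').Nonempty := nonempty_frontier_iff.mpr ⟨⟨f z, hfm hz⟩, hD'p⟩
  have hk : ‖deriv f z‖ * bdist D z / 4 ≤ bdist D' (f z) := by
    unfold bdist at hp' ⊢
    rw [le_infDist hne]
    intro w hw
    rw [dist_comm, dist_eq_norm]
    refine koebe f z _ hp (hf.mono hsub) (hinj.mono hsub) w ?_
    intro y hy h
    rw [hD'.frontier_eq] at hw
    exact hw.2 (h ▸ hfm (hsub hy))
  have h1 := (mDensity_bounds D hD hDb hDp z hz).1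
  have h2 := (mDensity_bounds D' hD' hD'b hD'p (f z) (hfm hz)).2
  calc mDensity D' (f z) * ‖deriv f z‖ ≤ 2 / bdist D' (f z) * ‖deriv f z‖ := by gcongr
    _ ≤ 8 * (1 / bdist D z) := by
      rw [div_mul_eq_mul_div, mul_one_div, div_le_div_iff₀ hp' hp]
      linarith
    _ ≤ _ := by gcongr

lemma path_image (D D' : Set ℂ) (hD : IsOpen D) (f : ℂ → ℂ) (hf : DifferentiableOn ℂ f D)
    (hfm : MapsTo f D D') (x y : ℂ) (γ : ℝ → ℂ) (hγ : IsRectPathIn D x y γ) :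
    IsRectPathIn D' (f x) (f y) (fun t => f (γ (projIcc (0:ℝ) 1 zero_le_one t))) := by
  obtain ⟨⟨K, hK⟩, h0, h1, hm⟩ := hγ
  have hcomp : IsCompact (γ '' Icc (0:ℝ) 1) := isCompact_Icc.image hK.continuous
  have hsub : γ '' Icc (0:ℝ) 1 ⊆ D := by rintro _ ⟨t, ht, rfl⟩; exact hm t ht
  have hll : LocallyLipschitzOn (γ '' Icc (0:ℝ) 1) f := by
    intro w hw
    have : ContDiffAt ℂ 1 f w := (hf.analyticAt (hD.mem_nhds (hsub hw))).contDiffAt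
    obtain ⟨L, t, ht, hL⟩ := this.exists_lipschitzOnWith
    exact ⟨L, t, nhdsWithin_le_nhds ht, hL⟩
  obtain ⟨L, hL⟩ := hll.exists_lipschitzOnWith_of_compact hcomp
  refine ⟨⟨L * K, ?_⟩, ?_, ?_, ?_⟩
  · have hp : LipschitzWith 1 (fun t => ((projIcc (0:ℝ) 1 zero_le_one t : Icc (0:ℝ) 1) : ℝ)) := 
      LipschitzWith.projIcc zero_le_one
    have h2 : LipschitzWith (K * 1) (fun t => γ (projIcc (0:ℝ) 1 zero_le_one t)) := hK.comp hp
    have h3 := hL.comp (h2.lipschitzOnWith (s := univ))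
      (fun t _ => ⟨_, (projIcc (0:ℝ) 1 zero_le_one t).2, rfl⟩)
    rw [mul_one, lipschitzOnWith_univ] at h3
    exact h3
  · simp [h0]
  · simp [h1]
  · intro t ht
    exact hfm (hm _ (projIcc (0:ℝ) 1 zero_le_one t).2)

lemma pathIntegral_nonneg' (D : Set ℂ) (hD : IsOpen D) (hDb : Bornology.IsBounded D)
    (hDp : D ≠ Set.univ) (x y : ℂ) (γ : ℝ → ℂ) (hγ : IsRectPathIn D x y γ) :
    0 ≤ pathIntegral (mDensity D) γ := by
  apply intervalIntegral.integral_nonneg zero_le_one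
  intro t ht
  exact mul_nonneg (mDensity_nonneg D hD hDb hDp _ (hγ.2.2.2 t ht)) (norm_nonneg _)

lemma pathIntegral_image (D D' : Set ℂ) (hD : IsOpen D) (hDb : Bornology.IsBounded D)
    (hDp : D ≠ Set.univ) (hD' : IsOpen D') (hD'b : Bornology.IsBounded D')
    (hD'p : D' ≠ Set.univ) (f : ℂ → ℂ) (hf : DifferentiableOn ℂ f D) (hinj : InjOn f D)
    (hfm : MapsTo f D D') (x y : ℂ) (γ : ℝ → ℂ) (hγ : IsRectPathIn D x y γ) :
    pathIntegral (mDensity D') (fun t => f (γ (projIcc (0:ℝ) 1 zero_le_one t))) ≤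
      8 * pathIntegral (mDensity D) γ := by
  obtain ⟨⟨K, hK⟩, h0, h1, hm⟩ := hγ
  unfold pathIntegral
  rw [← intervalIntegral.integral_const_mul, intervalIntegral.integral_of_le zero_le_one,
    intervalIntegral.integral_of_le zero_le_one, integral_Ioc_eq_integral_Ioo,
    integral_Ioc_eq_integral_Ioo]
  apply integral_mono_of_nonneg
  · filter_upwards [self_mem_ae_restrict measurableSet_Ioo] with t ht
    exact mul_nonneg (mDensity_nonneg D' hD' hD'b hD'p _
      (hfm (hm _ (projIcc (0:ℝ) 1 zero_le_one t).2))) (norm_nonneg _)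
  · apply Integrable.const_mul
    have hc : ContinuousOn (fun t => mDensity D (γ t)) (Icc 0 1) :=
      (mDensity_continuousOn D hD hDb hDp).comp hK.continuous.continuousOn hm
    have hi : IntegrableOn (fun t => mDensity D (γ t)) (Ioo 0 1) :=
      hc.integrableOn_Icc.mono_set Ioo_subset_Icc_self
    refine Integrable.mul_bdd (c := K) hi ?_ ?_
    · exact (measurable_deriv γ).norm.aestronglyMeasurable
    · refine Filter.Eventually.of_forall fun t => ?_
      rw [norm_norm]
      exact norm_deriv_le_of_lipschitz hK
  · filter_upwards [self_mem_ae_restrict measurableSet_Ioo,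
      ae_restrict_of_ae hK.ae_differentiableAt_real] with t ht hd
    have htI : t ∈ Icc (0:ℝ) 1 := Ioo_subset_Icc_self ht
    have hder : deriv (fun t => f (γ (projIcc (0:ℝ) 1 zero_le_one t))) t
        = deriv f (γ t) * deriv γ t := by
      have e : (fun t => f (γ (projIcc (0:ℝ) 1 zero_le_one t))) =ᶠ[𝓝 t] f ∘ γ := by
        filter_upwards [isOpen_Ioo.mem_nhds ht] with u hu
        simp [projIcc_of_mem zero_le_one (Ioo_subset_Icc_self hu)]
      rw [e.deriv_eq]
      have hfd : HasDerivAt f (deriv f (γ t)) (γ t) :=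
        (hf.differentiableAt (hD.mem_nhds (hm t htI))).hasDerivAt
      have := hfd.scomp t hd.hasDerivAt
      rw [this.deriv, smul_eq_mul, mul_comm]
    rw [hder, projIcc_of_mem zero_le_one htI, norm_mul, ← mul_assoc, ← mul_assoc]
    refine mul_le_mul_of_nonneg_right ?_ (norm_nonneg _)
    exact mDensity_conformal D D' hD hDb hDp hD' hD'b hD'p f hf hinj hfm _ (hm t htI)

lemma mDist_le (D D' : Set ℂ) (hD : IsOpen D) (hDb : Bornology.IsBounded D)
    (hDp : D ≠ Set.univ) (hD' : IsOpen D') (hD'b : Bornology.IsBounded D')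
    (hD'p : D' ≠ Set.univ) (f g : ℂ → ℂ) (hf : DifferentiableOn ℂ f D) (hinj : InjOn f D)
    (hfm : MapsTo f D D') (hg : DifferentiableOn ℂ g D') (hgm : MapsTo g D' D)
    (x y : ℂ) (hgx : g (f x) = x) (hgy : g (f y) = y) :
    mDist D' (f x) (f y) ≤ 8 * mDist D x y := by
  unfold mDist pathDist
  have hbdd : BddBelow (pathIntegral (mDensity D') '' {γ | IsRectPathIn D' (f x) (f y) γ}) := by
    refine ⟨0, ?_⟩
    rintro _ ⟨γ, hγ, rfl⟩
    exact pathIntegral_nonneg' D' hD' hD'b hD'p _ _ γ hγ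
  rcases {γ | IsRectPathIn D x y γ}.eq_empty_or_nonempty with he | hne
  · have he' : {γ | IsRectPathIn D' (f x) (f y) γ} = ∅ := by
      rw [eq_empty_iff_forall_notMem] at he ⊢
      intro γ hγ
      have := path_image D' D hD' g hg hgm _ _ γ hγ
      rw [hgx, hgy] at this
      exact he _ this
    rw [he, he']; simp
  · have : sInf (pathIntegral (mDensity D') '' {γ | IsRectPathIn D' (f x) (f y) γ}) / 8 ≤
        sInf (pathIntegral (mDensity D) '' {γ | IsRectPathIn D x y γ}) := by
      apply le_csInf (hne.image _)
      rintro _ ⟨γ, hγ, rfl⟩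
      have h1 := csInf_le hbdd ⟨_, path_image D D' hD f hf hfm x y γ hγ, rfl⟩
      have h2 := pathIntegral_image D D' hD hDb hDp hD' hD'b hD'p f hf hinj hfm x y γ hγ
      linarith
    linarith

/-- Proposition: conformal quasi-invariance of the $m_D$-metric.
If $f$ maps a bounded proper subdomain $D ⊂ ℂ$ conformally (injectively and
holomorphically) onto a bounded proper subdomain $D' = f(D)$, then
$(1/8) m_D(x,y) ≤ m_{D'}(f(x),f(y)) ≤ 8 m_D(x,y)$ for all $x, y ∈ D$. -/
theorem mDist_conformal (D D' : Set ℂ)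
    (hDopen : IsOpen D) (hDconn : IsConnected D)
    (hDbdd : Bornology.IsBounded D) (hDproper : D ≠ Set.univ)
    (hD'open : IsOpen D') (hD'conn : IsConnected D')
    (hD'bdd : Bornology.IsBounded D') (hD'proper : D' ≠ Set.univ)
    (f : ℂ → ℂ) (hf : DifferentiableOn ℂ f D) (hinj : Set.InjOn f D)
    (himage : f '' D = D')
    (x y : ℂ) (hx : x ∈ D) (hy : y ∈ D) :
    (1 / 8) * mDist D x y ≤ mDist D' (f x) (f y) ∧
      mDist D' (f x) (f y) ≤ 8 * mDist D x y := by
  set g := Function.invFunOn f D with hg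
  have hgf : ∀ z ∈ D, g (f z) = z := fun z hz => hinj.leftInvOn_invFunOn hz
  have hgd : DifferentiableOn ℂ g D' := by
    rw [← himage]
    exact inverse_holo D hDopen hDconn.isPreconnected f g hf hinj hgf
  have hfm : MapsTo f D D' := fun z hz => himage ▸ mem_image_of_mem f hz
  have hgm : MapsTo g D' D := by
    rw [← himage]
    rintro _ ⟨z, hz, rfl⟩
    rw [hgf z hz]; exact hz
  have hginj : InjOn g D' := by
    rw [← himage]
    rintro _ ⟨z, hz, rfl⟩ _ ⟨w, hw, rfl⟩ h
    rw [hgf z hz, hgf w hw] at h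
    rw [h]
  refine ⟨?_, mDist_le D D' hDopen hDbdd hDproper hD'open hD'bdd hD'proper f g hf hinj hfm hgd hgm
    x y (hgf x hx) (hgf y hy)⟩
  have := mDist_le D' D hD'open hD'bdd hD'proper hDopen hDbdd hDproper g f hgd hginj hgm hf hfm
    (f x) (f y) (by rw [hgf x hx]) (by rw [hgf y hy])
  rw [hgf x hx, hgf y hy] at this
  linarith
end

section
/- Let D be a bounded proper subdomain of ℝⁿ, n ≥ 2, and let x₁, x₂ ∈ D. Then there exists a rectifiable path γ joining x₁ and x₂ in D such that ∫_γ m_D(z)|dz| = m_D(x₁, x₂); that is, an m_D-geodesic between x₁ and x₂ always exists. -/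
open Metric Set

variable {E : Type*} [NormedAddCommGroup E] [NormedSpace ℝ E]

open Filter Topology MeasureTheory intervalIntegral

section geo

theorem lip_abs_sub_le {f g : ℝ → ℝ} {a b : ℝ} {K : NNReal} (hab : a ≤ b)
    (hf : LipschitzOnWith K f (Icc a b)) (hg : IntervalIntegrable g volume a b)
    (h : ∀ᵐ t : ℝ, t ∈ Ioo a b → |deriv f t| ≤ g t) : |f b - f a| ≤ ∫ t in a..b, g t := by
  have hac : AbsolutelyContinuousOnInterval f a b := by
    apply LipschitzOnWith.absolutelyContinuousOnInterval (K := K)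
    rwa [uIcc_of_le hab]
  rw [← hac.integral_deriv_eq_sub, ← Real.norm_eq_abs]
  apply intervalIntegral.norm_integral_le_of_norm_le hab _ hg
  have hb : ∀ᵐ t : ℝ, t ≠ b := by simp [ae_iff]
  filter_upwards [h, hb] with t ht htb hmem
  exact ht ⟨hmem.1, lt_of_le_of_ne hmem.2 htb⟩

theorem deriv_comp_lip {γ : ℝ → E} {u : E → ℝ} (hu : LipschitzWith 1 u) {t : ℝ}
    (hγ : DifferentiableAt ℝ γ t) : |deriv (fun s => u (γ s)) t| ≤ ‖deriv γ t‖ := by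
  by_cases hd : DifferentiableAt ℝ (fun s => u (γ s)) t
  · have h1 := (hasDerivAt_iff_tendsto_slope.1 hd.hasDerivAt).norm
    have h2 := (hasDerivAt_iff_tendsto_slope.1 hγ.hasDerivAt).norm
    refine le_of_tendsto_of_tendsto' h1 h2 fun s => ?_
    simp only [slope, norm_smul, vsub_eq_sub]
    gcongr
    simpa [dist_eq_norm] using hu.dist_le_mul (γ s) (γ t)
  · rw [deriv_zero_of_not_differentiableAt hd]; simp

variable [FiniteDimensional ℝ E]

theorem norm_deriv_ii {γ : ℝ → E} {K : NNReal} (hγ : LipschitzWith K γ) (a b : ℝ) :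
    IntervalIntegrable (fun t => ‖deriv γ t‖) volume a b := by
  have : ProperSpace E := FiniteDimensional.proper ℝ E
  borelize E
  apply (intervalIntegrable_const (c := (K:ℝ))).mono_fun
  · exact (measurable_deriv γ).norm.aestronglyMeasurable
  · filter_upwards with t
    simpa using norm_deriv_le_of_lipschitz hγ

theorem dens_ii {γ : ℝ → E} {K : NNReal} (hγ : LipschitzWith K γ) {D : Set E} {m : E → ℝ}
    (hm : ContinuousOn m D) (hD : ∀ t ∈ Icc (0:ℝ) 1, γ t ∈ D) {a b : ℝ}
    (ha : a ∈ Icc (0:ℝ) 1) (hb : b ∈ Icc (0:ℝ) 1) :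
    IntervalIntegrable (fun t => m (γ t) * ‖deriv γ t‖) volume a b := by
  apply (norm_deriv_ii hγ a b).continuousOn_mul
  apply hm.comp hγ.continuous.continuousOn
  intro t ht
  exact hD t (uIcc_subset_Icc ha hb ht)

theorem dist_le_len {γ : ℝ → E} {K : NNReal} (hγ : LipschitzWith K γ) {a b : ℝ} (hab : a ≤ b) :
    dist (γ b) (γ a) ≤ ∫ t in a..b, ‖deriv γ t‖ := by
  have hu : LipschitzWith 1 (fun z => dist z (γ a)) := LipschitzWith.dist_left (γ a)
  have := lip_abs_sub_le (f := fun t => dist (γ t) (γ a)) hab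
    ((hu.comp hγ).lipschitzOnWith) (norm_deriv_ii hγ a b) (by
      filter_upwards [hγ.ae_differentiableAt_real] with t ht _
      exact deriv_comp_lip hu ht)
  simpa using this

theorem loc_est {γ : ℝ → E} {K : NNReal} (hγ : LipschitzWith K γ) {D : Set E} {m : E → ℝ}
    (hm : ContinuousOn m D) (hD : ∀ t ∈ Icc (0:ℝ) 1, γ t ∈ D) {c : ℝ} (hc : 0 < c)
    (hcm : ∀ z ∈ D, c ≤ m z) {a b : ℝ}
    (ha : a ∈ Icc (0:ℝ) 1) (hb : b ∈ Icc (0:ℝ) 1) (hab : a ≤ b) {A ρ : ℝ}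
    (hA : ∫ t in a..b, m (γ t) * ‖deriv γ t‖ ≤ A)
    (hρ0 : 0 ≤ ρ) (hρ : ∀ z ∈ D, dist z (γ a) ≤ A / c → ρ ≤ m z) :
    ρ * dist (γ a) (γ b) ≤ A := by
  have key : ∀ t ∈ Icc a b, dist (γ t) (γ a) ≤ A / c := by
    intro t ht
    have htm : t ∈ Icc (0:ℝ) 1 := ⟨ha.1.trans ht.1, ht.2.trans hb.2⟩
    rw [le_div_iff₀' hc]
    calc c * dist (γ t) (γ a) ≤ c * ∫ t in a..t, ‖deriv γ t‖ := by
          gcongr; exact dist_le_len hγ ht.1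
      _ = ∫ t in a..t, c * ‖deriv γ t‖ := by rw [intervalIntegral.integral_const_mul]
      _ ≤ ∫ t in a..t, m (γ t) * ‖deriv γ t‖ := by
          apply intervalIntegral.integral_mono_on ht.1 ((norm_deriv_ii hγ _ _).const_mul c)
            (dens_ii hγ hm hD ha htm)
          intro s hs
          gcongr
          exact hcm _ (hD _ ⟨ha.1.trans hs.1, hs.2.trans htm.2⟩)
      _ ≤ ∫ t in a..b, m (γ t) * ‖deriv γ t‖ := by
          rw [← intervalIntegral.integral_add_adjacent_intervals (dens_ii hγ hm hD ha htm)
            (dens_ii hγ hm hD htm hb)]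
          have : 0 ≤ ∫ t in t..b, m (γ t) * ‖deriv γ t‖ := by
            apply intervalIntegral.integral_nonneg ht.2
            intro s hs
            have := hcm _ (hD s ⟨htm.1.trans hs.1, hs.2.trans hb.2⟩)
            have : 0 ≤ m (γ s) := by linarith
            positivity
          linarith
      _ ≤ A := hA
  calc ρ * dist (γ a) (γ b) ≤ ρ * ∫ t in a..b, ‖deriv γ t‖ := by
        gcongr; rw [dist_comm]; exact dist_le_len hγ hab
    _ = ∫ t in a..b, ρ * ‖deriv γ t‖ := by rw [intervalIntegral.integral_const_mul]
    _ ≤ ∫ t in a..b, m (γ t) * ‖deriv γ t‖ := by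
        apply intervalIntegral.integral_mono_on hab ((norm_deriv_ii hγ _ _).const_mul ρ)
          (dens_ii hγ hm hD ha hb)
        intro s hs
        gcongr
        exact hρ _ (hD _ ⟨ha.1.trans hs.1, hs.2.trans hb.2⟩) (key s hs)
    _ ≤ A := hA

theorem pathIntegral_nonneg'_s11 {D : Set E} {m : E → ℝ} {c : ℝ} (hc : 0 < c)
    (hcm : ∀ z ∈ D, c ≤ m z) {x y : E} {γ : ℝ → E} (hγ : IsRectPathIn D x y γ) :
    0 ≤ pathIntegral m γ := by
  apply intervalIntegral.integral_nonneg zero_le_one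
  intro s hs
  have := hcm _ (hγ.2.2.2 s hs)
  have : 0 ≤ m (γ s) := by linarith
  positivity

theorem reparam {D : Set E} {m : E → ℝ} (hm : ContinuousOn m D) {c : ℝ} (hc : 0 < c)
    (hcm : ∀ z ∈ D, c ≤ m z) {x y : E} (hxy : x ≠ y) {γ : ℝ → E} (hγ : IsRectPathIn D x y γ) :
    ∃ σ : ℝ → E, σ 0 = x ∧ σ 1 = y ∧ (∀ s ∈ Icc (0:ℝ) 1, ∃ t ∈ Icc (0:ℝ) 1, σ s = γ t) ∧
      ∀ s ∈ Icc (0:ℝ) 1, ∀ s' ∈ Icc (0:ℝ) 1, s ≤ s' → ∀ ρ : ℝ, 0 ≤ ρ →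
        (∀ z ∈ D, dist z (σ s) ≤ pathIntegral m γ * (s' - s) / c → ρ ≤ m z) →
        ρ * dist (σ s) (σ s') ≤ pathIntegral m γ * (s' - s) := by
  have hnn := pathIntegral_nonneg'_s11 hc hcm hγ
  obtain ⟨⟨K, hK⟩, h0, h1, hD⟩ := hγ
  set I := pathIntegral m γ with hI
  have m0 : (0:ℝ) ∈ Icc (0:ℝ) 1 := by simp
  have m1 : (1:ℝ) ∈ Icc (0:ℝ) 1 := by simp
  have hIpos : 0 < I := by
    have := loc_est hK hm hD hc hcm m0 m1 zero_le_one (A := I) (ρ := c) le_rfl hc.le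
      (fun z hz _ => hcm z hz)
    rw [h0, h1] at this
    have h2 : 0 < dist x y := dist_pos.2 hxy
    exact lt_of_lt_of_le (by positivity) this
  set F : ℝ → ℝ := fun t => ∫ u in (0:ℝ)..t, m (γ u) * ‖deriv γ u‖ with hF
  have hF0 : F 0 = 0 := by simp [hF]
  have hF1 : F 1 = I := rfl
  have hFc : ContinuousOn F (Icc 0 1) := by
    have := intervalIntegral.continuousOn_primitive_interval (μ := volume)
      (f := fun u => m (γ u) * ‖deriv γ u‖) (a := 0) (b := 1) (by
        rw [uIcc_of_le zero_le_one, integrableOn_Icc_iff_integrableOn_Ioc]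
        exact (intervalIntegrable_iff_integrableOn_Ioc_of_le zero_le_one).1
          (dens_ii hK hm hD m0 m1))
    rwa [uIcc_of_le zero_le_one] at this
  have hFsub : ∀ a ∈ Icc (0:ℝ) 1, ∀ b ∈ Icc (0:ℝ) 1,
      ∫ u in a..b, m (γ u) * ‖deriv γ u‖ = F b - F a := by
    intro a ha b hb
    have := intervalIntegral.integral_add_adjacent_intervals (dens_ii hK hm hD m0 ha)
            (dens_ii hK hm hD ha hb)
    simp only [hF]; linarith
  have hFmono : ∀ a ∈ Icc (0:ℝ) 1, ∀ b ∈ Icc (0:ℝ) 1, a ≤ b → F a ≤ F b := by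
    intro a ha b hb hab
    have : 0 ≤ ∫ t in a..b, m (γ t) * ‖deriv γ t‖ := by
      apply intervalIntegral.integral_nonneg hab
      intro s hs
      have := hcm _ (hD s ⟨ha.1.trans hs.1, hs.2.trans hb.2⟩)
      have : 0 ≤ m (γ s) := by linarith
      positivity
    rw [hFsub a ha b hb] at this
    linarith
  have hex : ∀ s : ℝ, ∃ t : ℝ, s ∈ Icc (0:ℝ) 1 → (t ∈ Icc (0:ℝ) 1 ∧ F t = I * s ∧
      (s = 0 → t = 0) ∧ (s = 1 → t = 1)) := by
    intro s
    by_cases hs : s ∈ Icc (0:ℝ) 1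
    · by_cases hs0 : s = 0
      · exact ⟨0, fun _ => ⟨m0, by simp [hF0, hs0], fun _ => rfl, by simp [hs0]⟩⟩
      by_cases hs1 : s = 1
      · exact ⟨1, fun _ => ⟨m1, by simp [hF1, hs1], by simp [hs1], fun _ => rfl⟩⟩
      obtain ⟨t, ht, hts⟩ := intermediate_value_Icc zero_le_one hFc
        (show I * s ∈ Icc (F 0) (F 1) by
          rw [hF0, hF1]; exact ⟨mul_nonneg hnn hs.1, mul_le_of_le_one_right hnn hs.2⟩)
      exact ⟨t, fun _ => ⟨ht, hts, fun h => absurd h hs0, fun h => absurd h hs1⟩⟩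
    · exact ⟨0, fun h => absurd h hs⟩
  choose τ hτ using hex
  refine ⟨fun s => γ (τ s), by simp [(hτ 0 m0).2.2.1 rfl, h0], by simp [(hτ 1 m1).2.2.2 rfl, h1],
    fun s hs => ⟨τ s, (hτ s hs).1, rfl⟩, ?_⟩
  intro s hs s' hs' hss ρ hρ0 hρ
  have hle : τ s ≤ τ s' := by
    by_contra hlt
    push Not at hlt
    have h2 := hFmono _ (hτ s' hs').1 _ (hτ s hs).1 hlt.le
    rw [(hτ s hs).2.1, (hτ s' hs').2.1] at h2
    have : s' ≤ s := le_of_mul_le_mul_left h2 hIpos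
    have : s = s' := le_antisymm hss this
    rw [this] at hlt
    exact lt_irrefl _ hlt
  refine loc_est hK hm hD hc hcm (hτ s hs).1 (hτ s' hs').1 hle ?_ hρ0 hρ
  rw [hFsub _ (hτ s hs).1 _ (hτ s' hs').1, (hτ s hs).2.1, (hτ s' hs').2.1]
  linarith

theorem geo {D : Set E} {m : E → ℝ} (hDo : IsOpen D) (hm : ContinuousOn m D) {c : ℝ} (hc : 0 < c)
    (hcm : ∀ z ∈ D, c ≤ m z) {x y : E} (hx : x ∈ D) (hne : ∃ γ, IsRectPathIn D x y γ)
    (hcpt : ∀ A : ℝ, ∃ K : Set E, IsCompact K ∧ K ⊆ D ∧ ∀ γ, IsRectPathIn D x y γ →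
      pathIntegral m γ ≤ A → ∀ t ∈ Icc (0:ℝ) 1, γ t ∈ K) :
    ∃ γ, IsRectPathIn D x y γ ∧ pathIntegral m γ = pathDist m D x y := by
  have hbdd : BddBelow (pathIntegral m '' {γ | IsRectPathIn D x y γ}) := by
    refine ⟨0, ?_⟩
    rintro _ ⟨γ, hγ, rfl⟩
    exact pathIntegral_nonneg'_s11 hc hcm hγ
  have hnem : (pathIntegral m '' {γ | IsRectPathIn D x y γ}).Nonempty := by
    obtain ⟨γ, hγ⟩ := hne
    exact ⟨_, γ, hγ, rfl⟩
  have hlow : ∀ γ, IsRectPathIn D x y γ → pathDist m D x y ≤ pathIntegral m γ :=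
    fun γ hγ => csInf_le hbdd ⟨γ, hγ, rfl⟩
  have hL0 : 0 ≤ pathDist m D x y := by
    apply le_csInf hnem
    rintro _ ⟨γ, hγ, rfl⟩
    exact pathIntegral_nonneg'_s11 hc hcm hγ
  suffices h : ∃ γ, IsRectPathIn D x y γ ∧ pathIntegral m γ ≤ pathDist m D x y by
    obtain ⟨γ, h1, h2⟩ := h
    exact ⟨γ, h1, le_antisymm h2 (hlow γ h1)⟩
  by_cases hxy : x = y
  · subst hxy
    refine ⟨fun _ => x, ⟨⟨0, LipschitzWith.const x⟩, rfl, rfl, fun _ _ => hx⟩, ?_⟩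
    simpa [pathIntegral] using hL0
  set L := pathDist m D x y with hL
  have hseq : ∀ k : ℕ, ∃ γ, IsRectPathIn D x y γ ∧ pathIntegral m γ < L + 1 / ((k:ℝ) + 1) := by
    intro k
    obtain ⟨_, ⟨γ, hγ, rfl⟩, h⟩ := exists_lt_of_csInf_lt hnem
      (show sInf _ < L + 1 / ((k:ℝ) + 1) by
        have : 0 < 1 / ((k:ℝ) + 1) := by positivity
        change L < _
        linarith)
    exact ⟨γ, hγ, h⟩
  choose g hg hgI using hseq
  set J : ℕ → ℝ := fun k => pathIntegral m (g k) with hJ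
  have hJlim : Tendsto J atTop (𝓝 L) := by
    refine tendsto_of_tendsto_of_tendsto_of_le_of_le tendsto_const_nhds
      (h := fun k : ℕ => L + 1 / ((k:ℝ) + 1)) ?_ (fun k => hlow _ (hg k)) (fun k => (hgI k).le)
    simpa using tendsto_const_nhds.add (tendsto_one_div_add_atTop_nhds_zero_nat (𝕜 := ℝ))
  have hJ1 : ∀ k, J k ≤ L + 1 := by
    intro k
    have : 1 / ((k:ℝ) + 1) ≤ 1 := by
      rw [div_le_one (by positivity)]
      have : (0:ℝ) ≤ k := by positivity
      linarith
    have := hgI k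
    simp only [hJ]; linarith
  obtain ⟨Kc, hKc, hKD, hKγ⟩ := hcpt (L + 1)
  choose S hS0 hS1 hSm hSest using fun k => reparam hm hc hcm hxy (hg k)
  let U : Ultrafilter ℕ := hyperfilter ℕ
  have hU : (U : Filter ℕ) ≤ atTop := Nat.hyperfilter_le_atTop
  have hJU : Tendsto J U (𝓝 L) := hJlim.mono_left hU
  have hlim : ∀ s : ℝ, ∃ p : E, s ∈ Icc (0:ℝ) 1 → (p ∈ Kc ∧ Tendsto (fun k => S k s) U (𝓝 p)) := by
    intro s
    by_cases hs : s ∈ Icc (0:ℝ) 1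
    · obtain ⟨p, hp, hp2⟩ := hKc.ultrafilter_le_nhds' (U.map (fun k => S k s)) (by
        rw [Ultrafilter.mem_map]
        refine Filter.univ_mem' fun k => ?_
        obtain ⟨t, ht, h⟩ := hSm k s hs
        change S k s ∈ Kc
        rw [h]
        exact hKγ _ (hg k) (hJ1 k) t ht)
      exact ⟨p, fun _ => ⟨hp, hp2⟩⟩
    · exact ⟨x, fun h => absurd h hs⟩
  choose σ hσ using hlim
  have m0 : (0:ℝ) ∈ Icc (0:ℝ) 1 := by simp
  have m1 : (1:ℝ) ∈ Icc (0:ℝ) 1 := by simp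
  have hσ0 : σ 0 = x := by
    refine tendsto_nhds_unique (hσ 0 m0).2 ?_
    simp only [hS0]; exact tendsto_const_nhds
  have hσ1 : σ 1 = y := by
    refine tendsto_nhds_unique (hσ 1 m1).2 ?_
    simp only [hS1]; exact tendsto_const_nhds
  have hlim2 : ∀ s ∈ Icc (0:ℝ) 1, ∀ s' ∈ Icc (0:ℝ) 1, ∀ ρ : ℝ,
      (∀ᶠ k in (U : Filter ℕ), ρ * dist (S k s) (S k s') ≤ J k * (s' - s)) →
      ρ * dist (σ s) (σ s') ≤ L * (s' - s) := by
    intro s hs s' hs' ρ h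
    exact le_of_tendsto_of_tendsto (((hσ s hs).2.dist (hσ s' hs').2).const_mul ρ)
      (hJU.mul_const _) h
  have hlipσ : ∀ s ∈ Icc (0:ℝ) 1, ∀ s' ∈ Icc (0:ℝ) 1, s ≤ s' →
      c * dist (σ s) (σ s') ≤ L * (s' - s) := by
    intro s hs s' hs' hss
    refine hlim2 s hs s' hs' c (Eventually.of_forall fun k => ?_)
    exact hSest k s hs s' hs' hss c hc.le (fun z hz _ => hcm z hz)
  have hloc : ∀ s ∈ Icc (0:ℝ) 1, ∀ ρ, 0 ≤ ρ → ρ < m (σ s) → ∃ r > 0, ∀ s' ∈ Icc (0:ℝ) 1,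
      s ≤ s' → s' - s ≤ r → ρ * dist (σ s) (σ s') ≤ L * (s' - s) := by
    intro s hs ρ hρ0 hρ
    have hmem : σ s ∈ D := hKD (hσ s hs).1
    have hev : ∀ᶠ z in 𝓝 (σ s), ρ < m z :=
      (hm.continuousAt (hDo.mem_nhds hmem)).eventually (lt_mem_nhds hρ)
    obtain ⟨ε, hε, hball⟩ := Metric.eventually_nhds_iff.1 hev
    refine ⟨ε / 2 * c / (L + 1), by positivity, ?_⟩
    intro s' hs' hss hr
    apply hlim2 s hs s' hs'
    have h1 := Metric.tendsto_nhds.1 (hσ s hs).2 (ε / 2) (by positivity)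
    filter_upwards [h1] with k hk
    refine hSest k s hs s' hs' hss ρ hρ0 ?_
    intro z hz hzd
    refine (hball ?_).le
    have h2 : J k * (s' - s) / c ≤ ε / 2 := by
      rw [div_le_iff₀ hc]
      rw [le_div_iff₀ (by positivity)] at hr
      have := mul_le_mul_of_nonneg_right (hJ1 k) (sub_nonneg.2 hss)
      linarith
    have := dist_triangle z (S k s) (σ s)
    change dist z (S k s) ≤ J k * (s' - s) / c at hzd
    linarith
  -- clamp
  let γ : ℝ → E := fun t => σ (projIcc (0:ℝ) 1 zero_le_one t)
  have hγσ : ∀ t ∈ Icc (0:ℝ) 1, γ t = σ t := by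
    intro t ht
    simp only [γ, projIcc_of_mem zero_le_one ht]
  have hLc : 0 ≤ L / c := by positivity
  have hlipon : LipschitzOnWith (Real.toNNReal (L / c)) σ (Icc 0 1) := by
    apply LipschitzOnWith.of_dist_le_mul
    intro s hs s' hs'
    rw [Real.coe_toNNReal _ hLc, div_mul_eq_mul_div, le_div_iff₀' hc]
    rcases le_total s s' with h | h
    · rw [Real.dist_eq, abs_sub_comm, abs_of_nonneg (sub_nonneg.2 h)]
      exact hlipσ s hs s' hs' h
    · rw [Real.dist_eq, abs_of_nonneg (sub_nonneg.2 h), dist_comm]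
      exact hlipσ s' hs' s hs h
  have hlipγ : LipschitzWith (Real.toNNReal (L / c)) γ := by
    have h := hlipon.to_restrict.comp (LipschitzWith.projIcc (zero_le_one (α := ℝ)))
    rw [mul_one] at h
    exact h
  refine ⟨γ, ⟨⟨_, hlipγ⟩, by rw [hγσ 0 m0, hσ0], by rw [hγσ 1 m1, hσ1], fun t ht => ?_⟩, ?_⟩
  · rw [hγσ t ht]; exact hKD (hσ t ht).1
  have hbound : ∀ t ∈ Ioo (0:ℝ) 1, ‖m (γ t) * ‖deriv γ t‖‖ ≤ L := by
    intro t ht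
    have htm : t ∈ Icc (0:ℝ) 1 := ⟨ht.1.le, ht.2.le⟩
    have hmpos : 0 < m (γ t) := by
      rw [hγσ t htm]; exact lt_of_lt_of_le hc (hcm _ (hKD (hσ t htm).1))
    rw [Real.norm_of_nonneg (by positivity)]
    by_cases hd : DifferentiableAt ℝ γ t
    swap
    · rw [deriv_zero_of_not_differentiableAt hd]; simpa using hL0
    have hρ : ∀ ρ, 0 ≤ ρ → ρ < m (γ t) → ρ * ‖deriv γ t‖ ≤ L := by
      intro ρ hρ0 hρ
      rw [hγσ t htm] at hρ
      obtain ⟨r, hr, hest⟩ := hloc t htm ρ hρ0 hρ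
      have hsl : Tendsto (fun s => ρ * ‖slope γ t s‖) (𝓝[>] t) (𝓝 (ρ * ‖deriv γ t‖)) := by
        refine Tendsto.const_mul _ (Tendsto.norm ?_)
        exact (hasDerivAt_iff_tendsto_slope.1 hd.hasDerivAt).mono_left
          (nhdsWithin_mono _ fun s hs => ne_of_gt hs)
      refine le_of_tendsto hsl ?_
      have hev : ∀ᶠ s in 𝓝[>] t, s ∈ Ioo t (min 1 (t + r)) :=
        Ioo_mem_nhdsGT (lt_min ht.2 (by linarith))
      filter_upwards [hev] with s hs
      have hs1 : s < 1 := lt_of_lt_of_le hs.2 (min_le_left _ _)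
      have hs2 : s < t + r := lt_of_lt_of_le hs.2 (min_le_right _ _)
      have hsm : s ∈ Icc (0:ℝ) 1 := ⟨ht.1.le.trans hs.1.le, hs1.le⟩
      have h := hest s hsm hs.1.le (by linarith)
      have hpos : 0 < s - t := sub_pos.2 hs.1
      rw [slope, norm_smul, vsub_eq_sub, ← dist_eq_norm, hγσ t htm, hγσ s hsm, norm_inv,
        Real.norm_of_nonneg hpos.le, dist_comm, inv_mul_eq_div, ← mul_div_assoc, div_le_iff₀ hpos]
      exact h
    have ht2 : Tendsto (fun ρ : ℝ => ρ * ‖deriv γ t‖) (𝓝[<] (m (γ t)))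
        (𝓝 (m (γ t) * ‖deriv γ t‖)) :=
      ((continuous_id.mul continuous_const).tendsto _).mono_left nhdsWithin_le_nhds
    refine le_of_tendsto ht2 ?_
    filter_upwards [Ioo_mem_nhdsLT hmpos] with ρ hρ'
    exact hρ ρ hρ'.1.le hρ'.2
  have hfin : ‖∫ t in (0:ℝ)..1, m (γ t) * ‖deriv γ t‖‖ ≤ L * |(1:ℝ) - 0| := by
    apply intervalIntegral.norm_integral_le_of_norm_le_const_ae
    have hb : ∀ᵐ t : ℝ, t ≠ 1 := by simp [ae_iff]
    filter_upwards [hb] with t ht htm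
    rw [uIoc_of_le zero_le_one] at htm
    exact hbound t ⟨htm.1, lt_of_le_of_ne htm.2 ht⟩
  simp only [sub_zero, abs_one, mul_one] at hfin
  exact (le_abs_self _).trans hfin

end geo

section dom

theorem path_trans {D : Set E} {x y z : E} (h1 : ∃ γ, IsRectPathIn D x y γ)
    (h2 : ∃ γ, IsRectPathIn D y z γ) : ∃ γ, IsRectPathIn D x z γ := by
  obtain ⟨γ, ⟨K, hK⟩, h0, h1, hD⟩ := h1
  obtain ⟨η, ⟨K', hK'⟩, h0', h1', hD'⟩ := h2
  let p : ℝ → ℝ := fun t => (projIcc (0:ℝ) 1 zero_le_one t : ℝ)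
  have hp : LipschitzWith 1 p :=
    (LipschitzWith.subtype_val _).comp (LipschitzWith.projIcc (zero_le_one (α := ℝ)))
      |>.weaken (by simp)
  have hpm : ∀ t, p t ∈ Icc (0:ℝ) 1 := fun t => (projIcc (0:ℝ) 1 zero_le_one t).2
  have hp0 : ∀ t ≤ 0, p t = 0 := fun t ht => by simp [p, projIcc_of_le_left zero_le_one ht]
  have hp1 : ∀ t, 1 ≤ t → p t = 1 := fun t ht => by simp [p, projIcc_of_right_le zero_le_one ht]
  have hl1 : LipschitzWith 2 (fun t : ℝ => 2 * t) := by
    apply LipschitzWith.of_dist_le_mul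
    intro a b
    simp [Real.dist_eq, ← mul_sub, abs_mul]
  have hl2 : LipschitzWith 2 (fun t : ℝ => 2 * t - 1) := by
    apply LipschitzWith.of_dist_le_mul
    intro a b
    simp [Real.dist_eq, ← mul_sub, abs_mul]
  refine ⟨fun t => γ (p (2 * t)) + η (p (2 * t - 1)) - y,
    ⟨_, ((hK.comp (hp.comp hl1)).add (hK'.comp (hp.comp hl2))).sub (LipschitzWith.const y)⟩,
    ?_, ?_, ?_⟩
  · simp only
    rw [hp0 (2 * 0) (by norm_num), hp0 (2 * 0 - 1) (by norm_num), h0, h0']; abel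
  · simp only
    rw [hp1 (2 * 1) (by norm_num), hp1 (2 * 1 - 1) (by norm_num), h1, h1']; abel
  · intro t _
    rcases le_total t (1 / 2) with h | h
    · simp only
      rw [hp0 (2 * t - 1) (by linarith), h0', add_sub_cancel_right]
      exact hD _ (hpm _)
    · simp only
      rw [hp1 (2 * t) (by linarith), h1, add_sub_cancel_left]
      exact hD' _ (hpm _)

theorem path_seg {D : Set E} {x y : E} (h : segment ℝ x y ⊆ D) : ∃ γ, IsRectPathIn D x y γ := by
  refine ⟨fun t => AffineMap.lineMap x y t, ⟨_, lipschitzWith_lineMap x y⟩, by simp, by simp, ?_⟩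
  intro t ht
  apply h
  rw [segment_eq_image_lineMap]
  exact ⟨t, ht, rfl⟩

theorem path_exists {D : Set E} (hDo : IsOpen D) (hDc : IsConnected D) {x y : E} (hx : x ∈ D)
    (hy : y ∈ D) : ∃ γ, IsRectPathIn D x y γ := by
  refine hDc.isPreconnected.induction₂' (fun x y => ∃ γ, IsRectPathIn D x y γ) ?_
    (fun x y z _ _ _ h1 h2 => path_trans h1 h2) hx hy
  intro z hz
  obtain ⟨ε, hε, hb⟩ := Metric.isOpen_iff.1 hDo z hz
  filter_upwards [nhdsWithin_le_nhds (Metric.ball_mem_nhds z hε)] with w hw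
  have hzm := Metric.mem_ball_self (x := z) hε
  exact ⟨path_seg (((convex_ball z ε).segment_subset hzm hw).trans hb),
    path_seg (((convex_ball z ε).segment_subset hw hzm).trans hb)⟩

theorem bdist_pos_s11 {D : Set E} (hDo : IsOpen D) (hf : (frontier D).Nonempty) {z : E} (hz : z ∈ D) :
    0 < bdist D z := by
  rw [bdist, ← isClosed_frontier.notMem_iff_infDist_pos hf, hDo.frontier_eq]
  exact fun h => h.2 hz

theorem bdist_lt_diam [Nontrivial E] {D : Set E} (hDo : IsOpen D) (hf : (frontier D).Nonempty)
    (hb : Bornology.IsBounded D) {z : E} (hz : z ∈ D) :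
    bdist D z < Metric.diam D := by
  have hpos := bdist_pos_s11 hDo hf hz
  have hdisj : Disjoint (ball z (bdist D z)) (frontier D) := Metric.disjoint_ball_infDist
  have hsub : ball z (bdist D z) ⊆ D := by
    by_contra hns
    obtain ⟨w, hw, hwD⟩ := Set.not_subset.1 hns
    have hfr : ∀ u ∈ ball z (bdist D z), u ∈ D ∨ u ∈ (closure D)ᶜ := by
      intro u hu
      by_contra hcon
      push Not at hcon
      refine Set.disjoint_left.1 hdisj hu ?_
      rw [hDo.frontier_eq]
      exact ⟨not_not.1 hcon.2, hcon.1⟩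
    obtain ⟨u, _, hu1, hu2⟩ := (convex_ball z (bdist D z)).isPreconnected D (closure D)ᶜ hDo
      isClosed_closure.isOpen_compl hfr ⟨z, mem_ball_self hpos, hz⟩
      ⟨w, hw, (hfr w hw).resolve_left hwD⟩
    exact hu2 (subset_closure hu1)
  have := Metric.diam_mono hsub hb
  rw [Metric.diam_ball_eq z hpos.le] at this
  linarith

theorem inv_le_mDensity [Nontrivial E] {D : Set E} (hDo : IsOpen D) (hf : (frontier D).Nonempty)
    (hb : Bornology.IsBounded D) {z : E} (hz : z ∈ D) : (bdist D z)⁻¹ ≤ mDensity D z := by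
  have h1 := bdist_pos_s11 hDo hf hz
  have h2 := bdist_lt_diam hDo hf hb hz
  rw [mDensity, inv_eq_one_div, div_le_div_iff₀ h1 (mul_pos h1 (sub_pos.2 h2))]
  nlinarith

theorem mDensity_cont [Nontrivial E] {D : Set E} (hDo : IsOpen D) (hf : (frontier D).Nonempty)
    (hb : Bornology.IsBounded D) : ContinuousOn (mDensity D) D := by
  have hc : Continuous (bdist D) := Metric.continuous_infDist_pt _
  refine ContinuousOn.div continuousOn_const
    (hc.mul (continuous_const.sub hc)).continuousOn fun z hz => ?_
  exact (mul_pos (bdist_pos_s11 hDo hf hz) (sub_pos.2 (bdist_lt_diam hDo hf hb hz))).ne'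

theorem log_lip {η a b : ℝ} (hη : 0 < η) (ha : η ≤ a) (hb : η ≤ b) :
    |Real.log a - Real.log b| ≤ η⁻¹ * |a - b| := by
  have key : ∀ a b : ℝ, η ≤ a → η ≤ b → Real.log a - Real.log b ≤ η⁻¹ * |a - b| := by
    intro a b ha hb
    have ha0 : 0 < a := hη.trans_le ha
    have hb0 : 0 < b := hη.trans_le hb
    rw [← Real.log_div ha0.ne' hb0.ne']
    calc Real.log (a / b) ≤ a / b - 1 := Real.log_le_sub_one_of_pos (div_pos ha0 hb0)
      _ = b⁻¹ * (a - b) := by field_simp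
      _ ≤ b⁻¹ * |a - b| := by gcongr; exact le_abs_self _
      _ ≤ η⁻¹ * |a - b| := by gcongr
  rw [abs_le]
  constructor
  · have := key b a hb ha
    rw [abs_sub_comm b a] at this
    linarith
  · exact key a b ha hb

variable [FiniteDimensional ℝ E]

theorem bdist_lower [Nontrivial E] {D : Set E} (hDo : IsOpen D) (hf : (frontier D).Nonempty)
    (hb : Bornology.IsBounded D) {x y : E} {γ : ℝ → E} (hγ : IsRectPathIn D x y γ) {A : ℝ}
    (hA : pathIntegral (mDensity D) γ ≤ A) {t : ℝ} (ht : t ∈ Icc (0:ℝ) 1) :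
    bdist D x * Real.exp (-A) ≤ bdist D (γ t) := by
  obtain ⟨⟨K, hK⟩, h0, h1, hD⟩ := hγ
  have hu : LipschitzWith 1 (bdist D) := Metric.lipschitz_infDist_pt _
  have hcont : Continuous fun s => bdist D (γ s) := hu.continuous.comp hK.continuous
  have m0 : (0:ℝ) ∈ Icc (0:ℝ) 1 := by simp
  have m1 : (1:ℝ) ∈ Icc (0:ℝ) 1 := by simp
  obtain ⟨s0, hs0, hmin⟩ := isCompact_Icc.exists_isMinOn ⟨0, m0⟩ hcont.continuousOn
  have hη := bdist_pos_s11 hDo hf (hD s0 hs0)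
  have hm := mDensity_cont hDo hf hb
  have hdpos : ∀ s ∈ Icc (0:ℝ) 1, 0 < mDensity D (γ s) := fun s hs =>
    lt_of_lt_of_le (inv_pos.2 (bdist_pos_s11 hDo hf (hD s hs))) (inv_le_mDensity hDo hf hb (hD s hs))
  have hlip : LipschitzOnWith (Real.toNNReal (bdist D (γ s0))⁻¹ * (1 * K))
      (fun s => Real.log (bdist D (γ s))) (Icc 0 t) := by
    apply LipschitzOnWith.of_dist_le_mul
    intro a ha b hb
    rw [NNReal.coe_mul, Real.coe_toNNReal _ (by positivity), mul_assoc]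
    refine (log_lip hη (hmin ⟨ha.1, ha.2.trans ht.2⟩) (hmin ⟨hb.1, hb.2.trans ht.2⟩)).trans ?_
    gcongr
    exact (hu.comp hK).dist_le_mul a b
  have hest := lip_abs_sub_le ht.1 hlip (dens_ii hK hm hD m0 ht) (by
    filter_upwards [hK.ae_differentiableAt_real, (hu.comp hK).ae_differentiableAt_real]
      with s hs1 hs2 hs
    have hsm : s ∈ Icc (0:ℝ) 1 := ⟨hs.1.le, hs.2.le.trans ht.2⟩
    have hp := bdist_pos_s11 hDo hf (hD s hsm)
    have hder : deriv (fun s => Real.log (bdist D (γ s))) s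
        = deriv (fun s => bdist D (γ s)) s / bdist D (γ s) :=
      deriv.log (f := fun s => bdist D (γ s)) hs2 hp.ne'
    rw [hder, abs_div, abs_of_pos hp, div_eq_inv_mul]
    exact mul_le_mul (inv_le_mDensity hDo hf hb (hD s hsm)) (deriv_comp_lip hu hs1)
      (abs_nonneg _) (hdpos s hsm).le)
  have hle : ∫ s in (0:ℝ)..t, mDensity D (γ s) * ‖deriv γ s‖ ≤ A := by
    refine le_trans ?_ hA
    rw [pathIntegral, ← intervalIntegral.integral_add_adjacent_intervals (dens_ii hK hm hD m0 ht)
      (dens_ii hK hm hD ht m1)]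
    have : 0 ≤ ∫ s in t..1, mDensity D (γ s) * ‖deriv γ s‖ := by
      apply intervalIntegral.integral_nonneg ht.2
      intro s hs
      have := hdpos s ⟨ht.1.trans hs.1, hs.2⟩
      positivity
    linarith
  have h3 := (abs_le.1 (hest.trans hle)).1
  simp only [h0] at h3
  have hx : 0 < bdist D x := by rw [← h0]; exact bdist_pos_s11 hDo hf (hD 0 m0)
  have ht0 := bdist_pos_s11 hDo hf (hD t ht)
  rw [← Real.log_le_log_iff (by positivity) ht0, Real.log_mul hx.ne' (Real.exp_pos _).ne',
    Real.log_exp]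
  linarith

theorem geo_dom [Nontrivial E] {D : Set E} (hDo : IsOpen D) (hDc : IsConnected D)
    (hb : Bornology.IsBounded D) (hDp : D ≠ univ) {x y : E} (hx : x ∈ D) (hy : y ∈ D) :
    ∃ γ, IsRectPathIn D x y γ ∧ pathIntegral (mDensity D) γ = mDist D x y := by
  have : ProperSpace E := FiniteDimensional.proper ℝ E
  have hf : (frontier D).Nonempty := nonempty_frontier_iff.2 ⟨hDc.nonempty, hDp⟩
  have hd : 0 < Metric.diam D := (bdist_pos_s11 hDo hf hx).trans (bdist_lt_diam hDo hf hb hx)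
  refine geo hDo (mDensity_cont hDo hf hb) (c := (Metric.diam D)⁻¹) (by positivity) ?_ hx
    (path_exists hDo hDc hx hy) ?_
  · intro z hz
    refine le_trans ?_ (inv_le_mDensity hDo hf hb hz)
    exact inv_anti₀ (bdist_pos_s11 hDo hf hz) (bdist_lt_diam hDo hf hb hz).le
  · intro A
    have hx0 := bdist_pos_s11 hDo hf hx
    have hc : Continuous (bdist D) := Metric.continuous_infDist_pt _
    refine ⟨closure D ∩ {z | bdist D x * Real.exp (-A) ≤ bdist D z}, ?_, ?_, ?_⟩
    · exact hb.isCompact_closure.inter_right (isClosed_le continuous_const hc)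
    · rintro z ⟨hz1, hz2⟩
      by_contra hz
      have hzf : z ∈ frontier D := by rw [hDo.frontier_eq]; exact ⟨hz1, hz⟩
      have h0 : bdist D z = 0 := Metric.infDist_zero_of_mem hzf
      have : 0 < bdist D x * Real.exp (-A) := by positivity
      have hz3 : bdist D x * Real.exp (-A) ≤ bdist D z := hz2
      linarith
    · intro γ hγ hA t ht
      exact ⟨subset_closure (hγ.2.2.2 t ht), bdist_lower hDo hf hb hγ hA ht⟩

end dom

/-- Theorem: existence of $m_D$-geodesics.
For a bounded proper subdomain $D ⊂ ℝ^n$, $n ≥ 2$, and $x_1, x_2 ∈ D$, there exists a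
rectifiable path $γ$ joining $x_1$ and $x_2$ in $D$ with
$∫_γ m_D(z)|dz| = m_D(x_1,x_2)$. -/
theorem mDist_geodesic_exists {n : ℕ} (hn : 2 ≤ n)
    (D : Set (EuclideanSpace ℝ (Fin n)))
    (hDopen : IsOpen D) (hDconn : IsConnected D)
    (hDbdd : Bornology.IsBounded D) (hDproper : D ≠ Set.univ)
    (x₁ x₂ : EuclideanSpace ℝ (Fin n)) (hx₁ : x₁ ∈ D) (hx₂ : x₂ ∈ D) :
    ∃ γ : ℝ → EuclideanSpace ℝ (Fin n), IsRectPathIn D x₁ x₂ γ ∧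
      pathIntegral (mDensity D) γ = mDist D x₁ x₂ := by
  have : Nonempty (Fin n) := ⟨⟨0, by omega⟩⟩
  exact geo_dom hDopen hDconn hDbdd hDproper hx₁ hx₂
end
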